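/- arXiv:2601.09990 — 4 statements merged into one kernel-verified Lean document; each statement's English description precedes it below -/
import Mathlib

section
/- Let d ≥ 1 be an integer and let n ≥ 3 be an odd integer. Given initial data u_in ∈ L^n(𝕋^d), suppose u₁ and u₂ are both weak solutions in L^n((0,∞); L^n(𝕋^d)) of the heat equation with damping of odd power, ∂_t u + u^n = Δu with u|_{t=0} = u_in, in the sense that for every T > 0, every t ∈ (0,T), and every test function ψ ∈ C_c^∞((−∞,T) × 𝕋^d) one has ∫_{𝕋^d} u(t,x)ψ(t,x) dx − ∫_{𝕋^d} u_in(x)ψ(0,x) dx − ∫_0^t ∫_{𝕋^d} u(s,x) ∂_s ψ(s,x) dx ds + ∫_0^t ∫_{𝕋^d} u^n(s,x) ψ(s,x) dx ds = ∫_0^t ∫_{𝕋^d} u(s,x) Δψ(s,x) dx ds. Then u₁ = u₂ almost everywhere on (0,∞) × 𝕋^d. -/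
open MeasureTheory

/-- The fundamental domain `[0,1)^d` of the torus `𝕋^d = (ℝ/ℤ)^d`. -/
def TorusBox (d : ℕ) : Set (Fin d → ℝ) := Set.univ.pi fun _ => Set.Ico (0 : ℝ) 1

/-- `ℤ^d`-periodicity of a function on `ℝ^d`, i.e. the function descends to `𝕋^d`. -/
def IsZdPeriodic {d : ℕ} (f : (Fin d → ℝ) → ℝ) : Prop :=
  ∀ (x : Fin d → ℝ) (k : Fin d → ℤ), f (x + fun i => (k i : ℝ)) = f x

/-- The Laplacian `Δf = ∑ i ∂²f/∂x_i²` of a function on `ℝ^d`. -/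
noncomputable def lapl {d : ℕ} (f : (Fin d → ℝ) → ℝ) (x : Fin d → ℝ) : ℝ :=
  ∑ i : Fin d, fderiv ℝ (fun y => fderiv ℝ f y (Pi.single i 1)) x (Pi.single i 1)

/-- A weak solution `u ∈ L^n((0,∞); L^n(𝕋^d))` of `∂_t u + u^n = Δu`, `u|_{t=0} = u_in`:
`u` is (jointly) measurable, `ℤ^d`-periodic in space, has finite `L^n((0,∞)×𝕋^d)` norm,
and for every `T > 0`, every `t ∈ (0,T)` and every smooth test function
`ψ ∈ C_c^∞((-∞,T) × 𝕋^d)` (smooth on `ℝ × ℝ^d`, `ℤ^d`-periodic in space, with compact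
support in time contained in `(-∞,T)`) the weak formulation
`∫ u(t)ψ(t) - ∫ u_in ψ(0) - ∫_0^t ∫ u ∂_s ψ + ∫_0^t ∫ u^n ψ = ∫_0^t ∫ u Δψ` holds. -/
def IsWeakSolutionOddHeat (d n : ℕ) (u_in : (Fin d → ℝ) → ℝ)
    (u : ℝ → (Fin d → ℝ) → ℝ) : Prop :=
  Measurable (Function.uncurry u) ∧
  (∀ t : ℝ, IsZdPeriodic (u t)) ∧
  (∫⁻ t in Set.Ioi (0 : ℝ), ∫⁻ x in TorusBox d, ENNReal.ofReal (|u t x| ^ n)) < ⊤ ∧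
  ∀ T : ℝ, 0 < T → ∀ t ∈ Set.Ioo 0 T, ∀ ψ : ℝ → (Fin d → ℝ) → ℝ,
    ContDiff ℝ (⊤ : ℕ∞) (fun p : ℝ × (Fin d → ℝ) => ψ p.1 p.2) →
    (∀ s : ℝ, IsZdPeriodic (ψ s)) →
    (∃ a b : ℝ, b < T ∧ ∀ s : ℝ, s ∉ Set.Icc a b → ∀ x, ψ s x = 0) →
    (∫ x in TorusBox d, u t x * ψ t x) - (∫ x in TorusBox d, u_in x * ψ 0 x)
        - (∫ s in Set.Ioc 0 t, ∫ x in TorusBox d, u s x * deriv (fun τ => ψ τ x) s)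
        + (∫ s in Set.Ioc 0 t, ∫ x in TorusBox d, u s x ^ n * ψ s x)
      = ∫ s in Set.Ioc 0 t, ∫ x in TorusBox d, u s x * lapl (ψ s) x

open Filter Topology

theorem isAddFundamentalDomain_torusBox_shift {d : ℕ} (a : Fin d → ℝ) :
    IsAddFundamentalDomain (Submodule.span ℤ (Set.range (Pi.basisFun ℝ (Fin d))))
      ((fun y => y - a) ⁻¹' TorusBox d) (volume : Measure (Fin d → ℝ)) := by
  have hB : TorusBox d = ZSpan.fundamentalDomain (Pi.basisFun ℝ (Fin d)) :=
    (ZSpan.fundamentalDomain_pi_basisFun).symm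
  refine IsAddFundamentalDomain.mk' ?_ fun x => ?_
  · rw [hB]
    exact ((measurable_id.sub_const a)
      (ZSpan.fundamentalDomain_measurableSet _)).nullMeasurableSet
  · rw [hB]
    have := ZSpan.exist_unique_vadd_mem_fundamentalDomain (Pi.basisFun ℝ (Fin d)) (x - a)
    simpa only [Set.mem_preimage, Submodule.vadd_def, vadd_eq_add, add_sub_assoc] using this

theorem IsZdPeriodic.vadd_eq {d : ℕ} {f : (Fin d → ℝ) → ℝ} (hf : IsZdPeriodic f)
    (g : Submodule.span ℤ (Set.range (Pi.basisFun ℝ (Fin d)))) (x : Fin d → ℝ) :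
    f (g +ᵥ x) = f x := by
  obtain ⟨g, hg⟩ := g
  rw [Module.Basis.mem_span_iff_repr_mem] at hg
  choose k hk using hg
  have : g = fun i => (k i : ℝ) := by
    ext i; simpa using (hk i).symm
  rw [Submodule.vadd_def, vadd_eq_add, add_comm]
  simp only [this]
  exact hf x k

instance vaddInvariantMeasure_span_basisFun {d : ℕ} :
    VAddInvariantMeasure (Submodule.span ℤ (Set.range (Pi.basisFun ℝ (Fin d)))) (Fin d → ℝ)
      volume :=
  ⟨fun g s _ => measure_preimage_add volume (g : Fin d → ℝ) s⟩

theorem preimage_sub_zero_torusBox (d : ℕ) :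
    (fun y => y - (0 : Fin d → ℝ)) ⁻¹' TorusBox d = TorusBox d := by
  simp

theorem IsZdPeriodic.setIntegral_shift {d : ℕ} {f : (Fin d → ℝ) → ℝ} (hf : IsZdPeriodic f)
    (a : Fin d → ℝ) :
    ∫ x in (fun y => y - a) ⁻¹' TorusBox d, f x = ∫ x in TorusBox d, f x := by
  conv_rhs => rw [← preimage_sub_zero_torusBox d]
  exact (isAddFundamentalDomain_torusBox_shift a).setIntegral_eq
    (isAddFundamentalDomain_torusBox_shift 0) hf.vadd_eq

theorem IsZdPeriodic.integrableOn_shift {d : ℕ} {f : (Fin d → ℝ) → ℝ} (hf : IsZdPeriodic f)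
    (a : Fin d → ℝ) (hi : IntegrableOn f (TorusBox d)) :
    IntegrableOn f ((fun y => y - a) ⁻¹' TorusBox d) := by
  rw [← preimage_sub_zero_torusBox d] at hi
  exact ((isAddFundamentalDomain_torusBox_shift a).integrableOn_iff
    (isAddFundamentalDomain_torusBox_shift 0) hf.vadd_eq).2 hi

theorem IsZdPeriodic.setIntegral_comp_add {d : ℕ} {f : (Fin d → ℝ) → ℝ} (hf : IsZdPeriodic f)
    (a : Fin d → ℝ) : ∫ x in TorusBox d, f (x + a) = ∫ x in TorusBox d, f x := by
  rw [← hf.setIntegral_shift a]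
  have h := (measurePreserving_add_right (volume : Measure (Fin d → ℝ)) a).setIntegral_preimage_emb
    (measurableEmbedding_addRight a) f ((fun y => y - a) ⁻¹' TorusBox d)
  rw [← h]
  congr 2
  ext x; simp

theorem IsZdPeriodic.setIntegral_comp_sub_left {d : ℕ} {f : (Fin d → ℝ) → ℝ}
    (hf : IsZdPeriodic f) (y : Fin d → ℝ) :
    ∫ x in TorusBox d, f (x - y) = ∫ x in TorusBox d, f x := by
  simpa only [sub_eq_add_neg] using hf.setIntegral_comp_add (-y)

theorem measurableSet_torusBox (d : ℕ) : MeasurableSet (TorusBox d) :=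
  MeasurableSet.univ_pi fun _ => measurableSet_Ico

theorem volume_torusBox (d : ℕ) : volume (TorusBox d) = 1 := by
  simp [TorusBox, Real.volume_pi_Ico]

instance isFiniteMeasure_restrict_torusBox (d : ℕ) :
    IsFiniteMeasure ((volume : Measure (Fin d → ℝ)).restrict (TorusBox d)) :=
  ⟨by simp [volume_torusBox]⟩

theorem IsZdPeriodic.exists_bound {d : ℕ} {f : (Fin d → ℝ) → ℝ} (hf : IsZdPeriodic f)
    (hc : Continuous f) : ∃ C, ∀ x, |f x| ≤ C := by
  obtain ⟨C, hC⟩ := (isCompact_univ_pi fun _ : Fin d => isCompact_Icc (a := (0 : ℝ)) (b := 1)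
    ).exists_bound_of_continuousOn hc.continuousOn
  refine ⟨C, fun x => ?_⟩
  have := hf (fun i => Int.fract (x i)) (fun i => ⌊x i⌋)
  have hx : ((fun i => Int.fract (x i)) + fun i => ((⌊x i⌋ : ℤ) : ℝ)) = x := by
    ext i; simp
  rw [hx] at this
  rw [this]
  exact hC _ fun i _ => ⟨Int.fract_nonneg _, (Int.fract_lt_one _).le⟩

theorem IsZdPeriodic.locallyIntegrable {d : ℕ} {f : (Fin d → ℝ) → ℝ} (hf : IsZdPeriodic f)
    (hi : IntegrableOn f (TorusBox d)) : LocallyIntegrable f := by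
  intro x
  refine ⟨_, ?_, hf.integrableOn_shift (fun i => x i - 1 / 2) hi⟩
  refine mem_of_superset (Metric.ball_mem_nhds x (ε := 1 / 2) (by norm_num)) fun y hy i _ => ?_
  have := (dist_pi_lt_iff (by norm_num)).1 (Metric.mem_ball.1 hy) i
  rw [Real.dist_eq, abs_lt] at this
  constructor <;> simp only [Pi.sub_apply] <;> linarith [this.1, this.2]

/-- The partial derivative in the `i`-th coordinate direction. -/
noncomputable def partialDeriv {d : ℕ} (i : Fin d) (f : (Fin d → ℝ) → ℝ) (x : Fin d → ℝ) : ℝ :=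
  fderiv ℝ f x (Pi.single i 1)

theorem lapl_eq_sum_partialDeriv {d : ℕ} (f : (Fin d → ℝ) → ℝ) (x : Fin d → ℝ) :
    lapl f x = ∑ i, partialDeriv i (partialDeriv i f) x := rfl

theorem ContDiff.partialDeriv {d : ℕ} {f : (Fin d → ℝ) → ℝ} (hf : ContDiff ℝ (⊤ : ℕ∞) f)
    (i : Fin d) : ContDiff ℝ (⊤ : ℕ∞) (partialDeriv i f) := by
  have : ContDiff ℝ (⊤ : ℕ∞) (fderiv ℝ f) := hf.fderiv_right (by simp)
  exact this.clm_apply contDiff_const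

theorem IsZdPeriodic.partialDeriv {d : ℕ} {f : (Fin d → ℝ) → ℝ} (hf : IsZdPeriodic f)
    (i : Fin d) : IsZdPeriodic (partialDeriv i f) := by
  intro x k
  have : (fun y => f (y + fun i => (k i : ℝ))) = f := funext fun y => hf y k
  unfold _root_.partialDeriv
  rw [← fderiv_comp_add_right, this]

theorem ContDiff.hasDerivAt_line {d : ℕ} {f : (Fin d → ℝ) → ℝ} (hf : ContDiff ℝ (⊤ : ℕ∞) f)
    (i : Fin d) (x : Fin d → ℝ) (h : ℝ) :
    HasDerivAt (fun h : ℝ => f (x + h • Pi.single i 1))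
      (_root_.partialDeriv i f (x + h • Pi.single i 1)) h := by
  have h1 : HasFDerivAt f (fderiv ℝ f (x + h • Pi.single i 1)) (x + h • Pi.single i 1) :=
    (hf.differentiable (by simp) _).hasFDerivAt
  have h2 : HasDerivAt (fun h : ℝ => x + h • (Pi.single i 1 : Fin d → ℝ)) (Pi.single i 1) h := by
    simpa using ((hasDerivAt_id h).smul_const (Pi.single i 1 : Fin d → ℝ)).const_add x
  exact h1.comp_hasDerivAt h h2

/-- The integral over a period of a directional derivative of a periodic function vanishes. -/
theorem setIntegral_line_deriv_eq_zero {d : ℕ} {F F' : (Fin d → ℝ) → ℝ} (e : Fin d → ℝ)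
    (hF : IsZdPeriodic F) (hFc : Continuous F) (hF' : IsZdPeriodic F') (hF'c : Continuous F')
    (hd : ∀ x h, HasDerivAt (fun h : ℝ => F (x + h • e)) (F' (x + h • e)) h) :
    ∫ x in TorusBox d, F' x = 0 := by
  obtain ⟨C, hC⟩ := hF.exists_bound hFc
  obtain ⟨C', hC'⟩ := hF'.exists_bound hF'c
  have key := (hasDerivAt_integral_of_dominated_loc_of_deriv_le
    (μ := (volume : Measure (Fin d → ℝ)).restrict (TorusBox d))
    (F := fun (h : ℝ) x => F (x + h • e)) (F' := fun h x => F' (x + h • e)) (x₀ := 0)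
    (bound := fun _ => C') univ_mem
    (Eventually.of_forall fun h => by
      exact (hFc.comp (by fun_prop)).aestronglyMeasurable)
    (by
      refine Integrable.of_bound (C := C) (hFc.comp (by fun_prop)).aestronglyMeasurable
        (Eventually.of_forall fun x => hC _))
    (hF'c.comp (by fun_prop)).aestronglyMeasurable
    (Eventually.of_forall fun x h _ => hC' _) (integrable_const _)
    (Eventually.of_forall fun x h _ => hd x h)).2
  simp only [hF.setIntegral_comp_add, zero_smul, add_zero] at key
  exact key.unique (hasDerivAt_const _ _)

/-- Convolution on the torus of a function `w` with a periodic kernel `η`. -/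
noncomputable def torusConv {d : ℕ} (η w : (Fin d → ℝ) → ℝ) (x : Fin d → ℝ) : ℝ :=
  ∫ y in TorusBox d, w y * η (x - y)

section TorusConv

variable {d : ℕ} {η w : (Fin d → ℝ) → ℝ}

theorem integrable_mul_kernel (hη : IsZdPeriodic η) (hc : Continuous η)
    (hw : IntegrableOn w (TorusBox d)) (x : Fin d → ℝ) :
    IntegrableOn (fun y => w y * η (x - y)) (TorusBox d) := by
  obtain ⟨C, hC⟩ := hη.exists_bound hc
  exact Integrable.mul_bdd (c := C) hw (hc.comp (by fun_prop)).aestronglyMeasurable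
    (Eventually.of_forall fun y => hC _)

theorem IsZdPeriodic.torusConv (hη : IsZdPeriodic η) : IsZdPeriodic (torusConv η w) := by
  intro x k
  unfold _root_.torusConv
  congr 1
  ext y
  rw [add_sub_right_comm, hη]

theorem continuous_torusConv (hη : IsZdPeriodic η) (hc : Continuous η)
    (hw : IntegrableOn w (TorusBox d)) : Continuous (torusConv η w) := by
  obtain ⟨C, hC⟩ := hη.exists_bound hc
  refine continuous_of_dominated (bound := fun y => |w y| * C)
    (fun x => (integrable_mul_kernel hη hc hw x).aestronglyMeasurable)
    (fun x => Eventually.of_forall fun y => ?_) (hw.abs.mul_const C)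
    (Eventually.of_forall fun y => by fun_prop)
  rw [Real.norm_eq_abs, abs_mul]
  exact mul_le_mul_of_nonneg_left (hC _) (abs_nonneg _)

theorem abs_torusConv_le {C : ℝ} (hC : ∀ x, |η x| ≤ C)
    (hw : IntegrableOn w (TorusBox d)) (x : Fin d → ℝ) :
    |torusConv η w x| ≤ C * ∫ y in TorusBox d, |w y| := by
  rw [← integral_const_mul]
  refine norm_integral_le_of_norm_le (f := fun y => w y * η (x - y)) (hw.abs.const_mul C)
    (Eventually.of_forall fun y => ?_)
  rw [Real.norm_eq_abs, abs_mul, mul_comm]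
  exact mul_le_mul_of_nonneg_right (hC _) (abs_nonneg _)

theorem hasDerivAt_torusConv_line (hη : IsZdPeriodic η) (hs : ContDiff ℝ (⊤ : ℕ∞) η)
    (hw : IntegrableOn w (TorusBox d)) (i : Fin d) (x : Fin d → ℝ) (h : ℝ) :
    HasDerivAt (fun h : ℝ => torusConv η w (x + h • Pi.single i 1))
      (torusConv (partialDeriv i η) w (x + h • Pi.single i 1)) h := by
  obtain ⟨C, hC⟩ := (hη.partialDeriv i).exists_bound (hs.partialDeriv i).continuous
  have hI : ∀ z, Integrable (fun y => w y * η (z - y)) (volume.restrict (TorusBox d)) :=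
    integrable_mul_kernel hη hs.continuous hw
  have hI' : ∀ z, Integrable (fun y => w y * partialDeriv i η (z - y))
      (volume.restrict (TorusBox d)) :=
    integrable_mul_kernel (hη.partialDeriv i) (hs.partialDeriv i).continuous hw
  have hb : ∀ y z, ‖w y * partialDeriv i η z‖ ≤ |w y| * C := fun y z => by
    rw [Real.norm_eq_abs, abs_mul]
    exact mul_le_mul_of_nonneg_left (hC _) (abs_nonneg _)
  have hd : ∀ y (h : ℝ), HasDerivAt (fun h : ℝ => w y * η (x + h • Pi.single i 1 - y))
      (w y * partialDeriv i η (x + h • Pi.single i 1 - y)) h := fun y h => by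
    simpa only [add_sub_right_comm] using (hs.hasDerivAt_line i (x - y) h).const_mul (w y)
  exact (hasDerivAt_integral_of_dominated_loc_of_deriv_le (x₀ := h) univ_mem
    (Eventually.of_forall fun h => (hI (x + h • Pi.single i 1)).aestronglyMeasurable)
    (hI (x + h • Pi.single i 1)) (hI' (x + h • Pi.single i 1)).aestronglyMeasurable
    (Eventually.of_forall fun y h _ => hb y (x + h • Pi.single i 1 - y)) (hw.abs.mul_const C)
    (Eventually.of_forall fun y h _ => hd y h)).2

theorem ContDiff.continuous_lapl {f : (Fin d → ℝ) → ℝ} (hs : ContDiff ℝ (⊤ : ℕ∞) f) :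
    Continuous (lapl f) :=
  continuous_finsetSum _ fun i _ => ((hs.partialDeriv i).partialDeriv i).continuous

theorem IsZdPeriodic.lapl {f : (Fin d → ℝ) → ℝ} (hf : IsZdPeriodic f) :
    IsZdPeriodic (lapl f) := fun x k =>
  Finset.sum_congr rfl fun i _ => (hf.partialDeriv i).partialDeriv i x k

theorem torusConv_lapl (hη : IsZdPeriodic η) (hs : ContDiff ℝ (⊤ : ℕ∞) η)
    (hw : IntegrableOn w (TorusBox d)) (x : Fin d → ℝ) :
    torusConv (lapl η) w x = ∑ i, torusConv (partialDeriv i (partialDeriv i η)) w x := by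
  simp only [torusConv, lapl_eq_sum_partialDeriv, Finset.mul_sum]
  exact integral_finsetSum _ fun i _ => integrable_mul_kernel
    ((hη.partialDeriv i).partialDeriv i) ((hs.partialDeriv i).partialDeriv i).continuous hw x

theorem IsZdPeriodic.integrableOn_of_continuous {f : (Fin d → ℝ) → ℝ} (hf : IsZdPeriodic f)
    (hc : Continuous f) : IntegrableOn f (TorusBox d) := by
  obtain ⟨C, hC⟩ := hf.exists_bound hc
  exact Integrable.of_bound (C := C) hc.aestronglyMeasurable (Eventually.of_forall hC)

theorem setIntegral_arctan_mul_torusConv_lapl_nonpos (hη : IsZdPeriodic η)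
    (hs : ContDiff ℝ (⊤ : ℕ∞) η) (hw : IntegrableOn w (TorusBox d)) :
    ∫ x in TorusBox d, Real.arctan (torusConv η w x) * torusConv (lapl η) w x ≤ 0 := by
  have hc := continuous_torusConv hη hs.continuous hw
  have hc1 := fun i => continuous_torusConv (hη.partialDeriv i) (hs.partialDeriv i).continuous hw
  have hc2 := fun i => continuous_torusConv ((hη.partialDeriv i).partialDeriv i)
    ((hs.partialDeriv i).partialDeriv i).continuous hw
  have hp := hη.torusConv (w := w)
  have hp1 := fun i => (hη.partialDeriv i).torusConv (w := w)
  have hp2 := fun i => ((hη.partialDeriv i).partialDeriv i).torusConv (w := w)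
  simp only [torusConv_lapl hη hs hw, Finset.mul_sum]
  have cA : ∀ i, Continuous fun x => Real.arctan (torusConv η w x)
      * torusConv (partialDeriv i (partialDeriv i η)) w x :=
    fun i => (Real.continuous_arctan.comp hc).mul (hc2 i)
  have pA : ∀ i, IsZdPeriodic fun x => Real.arctan (torusConv η w x)
      * torusConv (partialDeriv i (partialDeriv i η)) w x :=
    fun i x k => by simp only [hp x k, hp2 i x k]
  have cB : ∀ i, Continuous fun x => 1 / (1 + torusConv η w x ^ 2)
      * torusConv (partialDeriv i η) w x * torusConv (partialDeriv i η) w x := fun i =>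
    ((continuous_const.div (by fun_prop) fun x => by positivity).mul (hc1 i)).mul (hc1 i)
  have pB : ∀ i, IsZdPeriodic fun x => 1 / (1 + torusConv η w x ^ 2)
      * torusConv (partialDeriv i η) w x * torusConv (partialDeriv i η) w x :=
    fun i x k => by simp only [hp x k, hp1 i x k]
  rw [integral_finsetSum _ fun i _ => (pA i).integrableOn_of_continuous (cA i)]
  refine Finset.sum_nonpos fun i _ => ?_
  have key := setIntegral_line_deriv_eq_zero
    (F := fun x => Real.arctan (torusConv η w x) * torusConv (partialDeriv i η) w x)
    (F' := fun x => 1 / (1 + torusConv η w x ^ 2) * torusConv (partialDeriv i η) w x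
        * torusConv (partialDeriv i η) w x
      + Real.arctan (torusConv η w x) * torusConv (partialDeriv i (partialDeriv i η)) w x)
    (Pi.single i 1) (fun x k => by simp only [hp x k, hp1 i x k])
    ((Real.continuous_arctan.comp hc).mul (hc1 i))
    (fun x k => by simp only [hp x k, hp1 i x k, hp2 i x k])
    ((cB i).add (cA i))
    (fun x h => (hasDerivAt_torusConv_line hη hs hw i x h).arctan.mul
      (hasDerivAt_torusConv_line (hη.partialDeriv i) (hs.partialDeriv i) hw i x h))
  rw [integral_add ((pB i).integrableOn_of_continuous (cB i))
    ((pA i).integrableOn_of_continuous (cA i))] at key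
  have : 0 ≤ ∫ x in TorusBox d, 1 / (1 + torusConv η w x ^ 2)
      * torusConv (partialDeriv i η) w x * torusConv (partialDeriv i η) w x := by
    refine integral_nonneg fun x => ?_
    rw [mul_assoc]
    exact mul_nonneg (by positivity) (mul_self_nonneg _)
  linarith

end TorusConv

theorem Real.abs_arctan_le_two (x : ℝ) : |Real.arctan x| ≤ 2 :=
  abs_le.2 ⟨by linarith [Real.neg_pi_div_two_lt_arctan x, Real.pi_le_four],
    by linarith [Real.arctan_lt_pi_div_two x, Real.pi_le_four]⟩

theorem integral_arctan_nonneg (r : ℝ) : 0 ≤ ∫ τ in (0 : ℝ)..r, Real.arctan τ := by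
  rcases le_total 0 r with h | h
  · exact intervalIntegral.integral_nonneg h fun x hx => Real.arctan_nonneg.2 hx.1
  · rw [intervalIntegral.integral_symm, ← intervalIntegral.integral_neg]
    exact intervalIntegral.integral_nonneg h fun x hx =>
      neg_nonneg.2 (Real.arctan_le_zero.2 hx.2)

/-- The chain rule for the primitive `W` of an integrable function `g`, composed with the
primitive of `arctan`. -/
theorem setIntegral_arctan_primitive_mul_nonneg {g : ℝ → ℝ} {t : ℝ} (ht : 0 ≤ t)
    (hg : IntegrableOn g (Set.Ioc 0 t)) :
    0 ≤ ∫ s in Set.Ioc 0 t, Real.arctan (∫ r in Set.Ioc 0 s, g r) * g s := by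
  set W : ℝ → ℝ := fun s => ∫ r in (0 : ℝ)..s, g r with hW
  set j : ℝ → ℝ := fun r => ∫ τ in (0 : ℝ)..r, Real.arctan τ with hj
  have hgi : IntervalIntegrable g volume 0 t :=
    (intervalIntegrable_iff_integrableOn_Ioc_of_le ht).2 hg
  have hac : AbsolutelyContinuousOnInterval W 0 t :=
    hgi.absolutelyContinuousOnInterval_intervalIntegral (by simp)
  have hjd : ∀ r, HasDerivAt j (Real.arctan r) r := fun r =>
    intervalIntegral.integral_hasDerivAt_right (Real.continuous_arctan.intervalIntegrable _ _)
      (Real.continuous_arctan.stronglyMeasurableAtFilter _ _) Real.continuous_arctan.continuousAt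
  have hlip : ∀ a b, dist (j a) (j b) ≤ 2 * dist a b := by
    intro a b
    have : LipschitzWith 2 j := lipschitzWith_of_nnnorm_deriv_le
      (fun r => (hjd r).differentiableAt) fun r => by
        rw [(hjd r).deriv]
        exact_mod_cast Real.abs_arctan_le_two r
    simpa using this.dist_le_mul a b
  have hac' : AbsolutelyContinuousOnInterval (fun s => j (W s)) 0 t := by
    have h0 := Tendsto.const_mul 2 hac
    rw [mul_zero] at h0
    refine squeeze_zero (fun E => Finset.sum_nonneg fun _ _ => dist_nonneg) (fun E => ?_) h0
    rw [Finset.mul_sum]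
    exact Finset.sum_le_sum fun i _ => hlip _ _
  have hftc := hac'.integral_deriv_eq_sub
  have hae := hgi.ae_hasDerivAt_integral
  rw [intervalIntegral.integral_of_le ht] at hftc
  have : ∫ s in Set.Ioc 0 t, Real.arctan (∫ r in Set.Ioc 0 s, g r) * g s
      = ∫ s in Set.Ioc 0 t, deriv (fun s => j (W s)) s := by
    refine setIntegral_congr_ae measurableSet_Ioc ?_
    filter_upwards [hae] with s hs hst
    have h1 : HasDerivAt W (g s) s :=
      hs (by rw [Set.uIcc_of_le ht]; exact ⟨hst.1.le, hst.2⟩) 0 (by simp)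
    have h2 := (hjd (W s)).comp s h1
    rw [← intervalIntegral.integral_of_le hst.1.le]
    exact h2.deriv.symm
  rw [this, hftc]
  have h0 : j (W 0) = 0 := by simp [hj, hW]
  rw [h0, sub_zero]
  exact integral_arctan_nonneg _

theorem partialDeriv_comp_const_sub {d : ℕ} {f : (Fin d → ℝ) → ℝ} (hf : Differentiable ℝ f)
    (i : Fin d) (x y : Fin d → ℝ) :
    partialDeriv i (fun y => f (x - y)) y = -partialDeriv i f (x - y) := by
  have h1 : HasFDerivAt (fun y => x - y) (-ContinuousLinearMap.id ℝ (Fin d → ℝ)) y :=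
    (hasFDerivAt_id y).const_sub x
  have h2 := (hf (x - y)).hasFDerivAt.comp y h1
  unfold partialDeriv
  erw [h2.fderiv]
  simp

theorem lapl_comp_const_sub {d : ℕ} {f : (Fin d → ℝ) → ℝ} (hf : ContDiff ℝ (⊤ : ℕ∞) f)
    (x y : Fin d → ℝ) : lapl (fun y => f (x - y)) y = lapl f (x - y) := by
  simp only [lapl_eq_sum_partialDeriv]
  refine Finset.sum_congr rfl fun i _ => ?_
  have : partialDeriv i (fun y => f (x - y)) = fun y => (-partialDeriv i f) (x - y) :=
    funext fun y => partialDeriv_comp_const_sub (hf.differentiable (by simp)) i x y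
  have hd := (hf.partialDeriv i).differentiable (by simp)
  rw [this, partialDeriv_comp_const_sub hd.neg]
  simp [partialDeriv, fderiv_neg]

/-- The weak formulation tested against a translated periodic kernel. -/
theorem IsWeakSolutionOddHeat.torusConv_eq {d n : ℕ} {u_in : (Fin d → ℝ) → ℝ}
    {u : ℝ → (Fin d → ℝ) → ℝ} (h : IsWeakSolutionOddHeat d n u_in u) {η : (Fin d → ℝ) → ℝ}
    (hη : IsZdPeriodic η) (hs : ContDiff ℝ (⊤ : ℕ∞) η) {t : ℝ} (ht : 0 < t) (x : Fin d → ℝ) :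
    torusConv η (u t) x - torusConv η u_in x
        + ∫ s in Set.Ioc 0 t, torusConv η (fun y => u s y ^ n) x
      = ∫ s in Set.Ioc 0 t, torusConv (lapl η) (u s) x := by
  let χ : ContDiffBump (0 : ℝ) := ⟨t + 1 / 2, t + 1, by linarith, by linarith⟩
  have hχ1 : ∀ s ∈ Set.Icc 0 t, χ =ᶠ[𝓝 s] 1 := fun s hs => by
    refine χ.eventuallyEq_one_of_mem_ball ?_
    rw [Metric.mem_ball, Real.dist_eq, sub_zero, abs_of_nonneg hs.1]
    change s < t + 1 / 2
    linarith [hs.2]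
  have hχ : ∀ s ∈ Set.Icc 0 t, χ s = 1 := fun s hs => (hχ1 s hs).self_of_nhds
  have key := h.2.2.2 (t + 2) (by linarith) t ⟨ht, by linarith⟩
    (fun s y => χ s * η (x - y))
    ((χ.contDiff.comp contDiff_fst).mul (hs.comp (contDiff_const.sub contDiff_snd)))
    (fun s y k => by
      have := hη (x - (y + fun i => (k i : ℝ))) k
      beta_reduce
      rw [← this]
      congr 2
      abel)
    ⟨-(t + 1), t + 1, by linarith, fun s hs y => by
      rw [χ.zero_of_le_dist, zero_mul]
      rw [Real.dist_eq, sub_zero]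
      change t + 1 ≤ |s|
      by_contra hlt
      exact hs (abs_le.1 (not_le.1 hlt).le)⟩
  simp only [hχ t ⟨ht.le, le_rfl⟩, hχ 0 ⟨le_rfl, ht.le⟩, one_mul] at key
  have e1 : ∫ s in Set.Ioc 0 t, ∫ y in TorusBox d, u s y * deriv (fun τ => χ τ * η (x - y)) s
      = 0 := by
    rw [setIntegral_congr_fun (g := fun _ => (0 : ℝ)) measurableSet_Ioc fun s hst => ?_]
    · simp
    · have : ∀ y, deriv (fun τ => χ τ * η (x - y)) s = 0 := fun y => by
        have : (fun τ => χ τ * η (x - y)) =ᶠ[𝓝 s] fun _ => η (x - y) := by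
          filter_upwards [hχ1 s ⟨hst.1.le, hst.2⟩] with τ hτ
          simp [hτ]
        rw [this.deriv_eq, deriv_const]
      simp [this]
  have e2 : ∫ s in Set.Ioc 0 t, ∫ y in TorusBox d, u s y ^ n * (χ s * η (x - y))
      = ∫ s in Set.Ioc 0 t, torusConv η (fun y => u s y ^ n) x :=
    setIntegral_congr_fun measurableSet_Ioc fun s hst => by
      simp [torusConv, hχ s ⟨hst.1.le, hst.2⟩]
  have e3 : ∫ s in Set.Ioc 0 t, ∫ y in TorusBox d, u s y * lapl (fun y => χ s * η (x - y)) y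
      = ∫ s in Set.Ioc 0 t, torusConv (lapl η) (u s) x :=
    setIntegral_congr_fun measurableSet_Ioc fun s hst => by
      simp [torusConv, hχ s ⟨hst.1.le, hst.2⟩, lapl_comp_const_sub hs]
  rw [e1, e2, e3, sub_zero] at key
  exact key

section SpaceTime

variable {d : ℕ} {κ : (Fin d → ℝ) → ℝ} {u : ℝ → (Fin d → ℝ) → ℝ} {μ : Measure ℝ}

theorem measurable_torusConv_uncurry (hc : Continuous κ) (hu : Measurable (Function.uncurry u)) :
    Measurable fun p : ℝ × (Fin d → ℝ) => torusConv κ (u p.1) p.2 := by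
  have : Measurable fun q : (ℝ × (Fin d → ℝ)) × (Fin d → ℝ) =>
      u q.1.1 q.2 * κ (q.1.2 - q.2) :=
    (hu.comp (by fun_prop : Measurable fun q : (ℝ × (Fin d → ℝ)) × (Fin d → ℝ) =>
      (q.1.1, q.2))).mul (hc.measurable.comp (by fun_prop))
  exact this.stronglyMeasurable.integral_prod_right.measurable

theorem integrable_torusConv_uncurry [SFinite μ] (hκ : IsZdPeriodic κ) (hc : Continuous κ)
    (hu : Measurable (Function.uncurry u))
    (hi : Integrable (Function.uncurry u) (μ.prod (volume.restrict (TorusBox d)))) :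
    Integrable (fun p : ℝ × (Fin d → ℝ) => torusConv κ (u p.1) p.2)
      (μ.prod (volume.restrict (TorusBox d))) := by
  obtain ⟨C, hC⟩ := hκ.exists_bound hc
  have hI : Integrable (fun s => C * ∫ y in TorusBox d, |u s y|) μ :=
    hi.abs.integral_prod_left.const_mul C
  refine Integrable.mono' (hI.comp_fst (volume.restrict (TorusBox d)))
    (measurable_torusConv_uncurry hc hu).aestronglyMeasurable ?_
  have h1 : ∀ᵐ s ∂μ, ∀ x, |torusConv κ (u s) x| ≤ C * ∫ y in TorusBox d, |u s y| := by
    filter_upwards [hi.prod_right_ae] with s hs x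
    exact abs_torusConv_le hC hs x
  filter_upwards [Measure.quasiMeasurePreserving_fst.ae h1] with p hp
  exact hp p.2

theorem integrable_torusConv_time (hκ : IsZdPeriodic κ) (hc : Continuous κ)
    (hi : Integrable (Function.uncurry u) (μ.prod (volume.restrict (TorusBox d))))
    (x : Fin d → ℝ) : Integrable (fun s => torusConv κ (u s) x) μ := by
  obtain ⟨C, hC⟩ := hκ.exists_bound hc
  have : Integrable (fun p : ℝ × (Fin d → ℝ) => Function.uncurry u p * κ (x - p.2))
      (μ.prod (volume.restrict (TorusBox d))) :=
    hi.mul_bdd (c := C) (hc.comp (by fun_prop)).aestronglyMeasurable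
      (Eventually.of_forall fun p => hC _)
  exact this.integral_prod_left

theorem torusConv_sub {v w : (Fin d → ℝ) → ℝ} (hκ : IsZdPeriodic κ) (hc : Continuous κ)
    (hv : IntegrableOn v (TorusBox d)) (hw : IntegrableOn w (TorusBox d)) (x : Fin d → ℝ) :
    torusConv κ (fun y => v y - w y) x = torusConv κ v x - torusConv κ w x := by
  simp only [torusConv, sub_mul]
  exact integral_sub (integrable_mul_kernel hκ hc hv x) (integrable_mul_kernel hκ hc hw x)

theorem integral_torusConv_eq {v : (Fin d → ℝ) → ℝ} (hκ : IsZdPeriodic κ) (hc : Continuous κ)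
    (hv : IntegrableOn v (TorusBox d)) :
    ∫ x in TorusBox d, torusConv κ v x
      = (∫ y in TorusBox d, v y) * ∫ x in TorusBox d, κ x := by
  obtain ⟨C, hC⟩ := hκ.exists_bound hc
  have hv' : Integrable v (volume.restrict (TorusBox d)) := hv
  have : Integrable (Function.uncurry fun x y => v y * κ (x - y))
      ((volume.restrict (TorusBox d)).prod (volume.restrict (TorusBox d))) :=
    (hv'.comp_snd (volume.restrict (TorusBox d))).mul_bdd (c := C)
      (hc.comp (by fun_prop)).aestronglyMeasurable (Eventually.of_forall fun p => hC _)
  unfold torusConv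
  rw [integral_integral_swap this]
  simp only [integral_const_mul, hκ.setIntegral_comp_sub_left, integral_mul_const]

end SpaceTime

theorem abs_le_one_add_abs_pow (x : ℝ) {n : ℕ} (hn : n ≠ 0) : |x| ≤ 1 + |x| ^ n := by
  rcases le_total |x| 1 with h | h
  · linarith [pow_nonneg (abs_nonneg x) n]
  · linarith [le_self_pow₀ h hn]

theorem IsWeakSolutionOddHeat.integrable_pow {d n : ℕ} {u_in : (Fin d → ℝ) → ℝ}
    {u : ℝ → (Fin d → ℝ) → ℝ} (h : IsWeakSolutionOddHeat d n u_in u) (t : ℝ) :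
    Integrable (Function.uncurry fun s y => u s y ^ n)
      ((volume.restrict (Set.Ioc 0 t)).prod (volume.restrict (TorusBox d))) := by
  have hm : Measurable (Function.uncurry fun s y => u s y ^ n) := h.1.pow_const n
  refine ⟨hm.aestronglyMeasurable, ?_⟩
  rw [hasFiniteIntegral_iff_norm, lintegral_prod _ hm.norm.ennreal_ofReal.aemeasurable]
  refine lt_of_le_of_lt ?_ h.2.2.1
  simp only [Function.uncurry, Real.norm_eq_abs, abs_pow]
  exact lintegral_mono_set Set.Ioc_subset_Ioi_self

theorem IsWeakSolutionOddHeat.integrable {d n : ℕ} {u_in : (Fin d → ℝ) → ℝ}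
    {u : ℝ → (Fin d → ℝ) → ℝ} (h : IsWeakSolutionOddHeat d n u_in u) (hn : n ≠ 0) (t : ℝ) :
    Integrable (Function.uncurry u)
      ((volume.restrict (Set.Ioc 0 t)).prod (volume.restrict (TorusBox d))) := by
  refine ((integrable_const (1 : ℝ)).add (h.integrable_pow t).abs).mono'
    h.1.aestronglyMeasurable (Eventually.of_forall fun p => ?_)
  simpa [Function.uncurry] using abs_le_one_add_abs_pow (u p.1 p.2) hn

/-- Kato's inequality for the difference of two weak solutions, mollified by a periodic kernel. -/
theorem integral_arctan_torusConv_mul_nonpos {d n : ℕ} (hn : n ≠ 0) {u_in : (Fin d → ℝ) → ℝ}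
    {u₁ u₂ : ℝ → (Fin d → ℝ) → ℝ} (h₁ : IsWeakSolutionOddHeat d n u_in u₁)
    (h₂ : IsWeakSolutionOddHeat d n u_in u₂) {η : (Fin d → ℝ) → ℝ}
    (hη : IsZdPeriodic η) (hs : ContDiff ℝ (⊤ : ℕ∞) η) {t : ℝ} (ht : 0 ≤ t) :
    ∫ p : ℝ × (Fin d → ℝ), Real.arctan (torusConv η (fun y => u₁ p.1 y - u₂ p.1 y) p.2)
        * torusConv η (fun y => u₁ p.1 y ^ n - u₂ p.1 y ^ n) p.2
      ∂((volume.restrict (Set.Ioc 0 t)).prod (volume.restrict (TorusBox d))) ≤ 0 := by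
  set μ : Measure ℝ := volume.restrict (Set.Ioc 0 t) with hμ
  set ν : Measure (Fin d → ℝ) := volume.restrict (TorusBox d) with hν
  set w : ℝ → (Fin d → ℝ) → ℝ := fun s y => u₁ s y - u₂ s y with hw
  set f : ℝ → (Fin d → ℝ) → ℝ := fun s y => u₁ s y ^ n - u₂ s y ^ n with hf
  have wm : Measurable (Function.uncurry w) := h₁.1.sub h₂.1
  have fm : Measurable (Function.uncurry f) := (h₁.1.pow_const n).sub (h₂.1.pow_const n)
  have i1 := h₁.integrable hn t
  have i2 := h₂.integrable hn t
  have p1 := h₁.integrable_pow t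
  have p2 := h₂.integrable_pow t
  have wi : Integrable (Function.uncurry w) (μ.prod ν) := i1.sub i2
  have fi : Integrable (Function.uncurry f) (μ.prod ν) := p1.sub p2
  have hlc := hs.continuous_lapl
  have hlp := hη.lapl
  set V : ℝ → (Fin d → ℝ) → ℝ := fun s x => torusConv η (w s) x with hV
  set L : ℝ → (Fin d → ℝ) → ℝ := fun s x => torusConv (lapl η) (w s) x with hL
  set G : ℝ → (Fin d → ℝ) → ℝ := fun s x => torusConv η (f s) x with hG
  have Vm : Measurable (Function.uncurry V) := measurable_torusConv_uncurry hs.continuous wm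
  have Li : Integrable (Function.uncurry L) (μ.prod ν) :=
    integrable_torusConv_uncurry hlp hlc wm wi
  have Gi : Integrable (Function.uncurry G) (μ.prod ν) :=
    integrable_torusConv_uncurry hη hs.continuous fm fi
  have aLi : Integrable (fun p : ℝ × (Fin d → ℝ) => Real.arctan (V p.1 p.2) * L p.1 p.2)
      (μ.prod ν) := Li.bdd_mul (c := 2) (Real.measurable_arctan.comp Vm).aestronglyMeasurable
        (Eventually.of_forall fun p => Real.abs_arctan_le_two _)
  have aGi : Integrable (fun p : ℝ × (Fin d → ℝ) => Real.arctan (V p.1 p.2) * G p.1 p.2)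
      (μ.prod ν) := Gi.bdd_mul (c := 2) (Real.measurable_arctan.comp Vm).aestronglyMeasurable
        (Eventually.of_forall fun p => Real.abs_arctan_le_two _)
  have hgood : ∀ᵐ s ∂μ, IntegrableOn (u₁ s) (TorusBox d) ∧ IntegrableOn (u₂ s) (TorusBox d) ∧
      IntegrableOn (fun y => u₁ s y ^ n) (TorusBox d) ∧
      IntegrableOn (fun y => u₂ s y ^ n) (TorusBox d) := by
    filter_upwards [i1.prod_right_ae, i2.prod_right_ae, p1.prod_right_ae, p2.prod_right_ae]
      with s a b c e using ⟨a, b, c, e⟩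
  have hVprim : ∀ᵐ s ∂μ, ∀ x, V s x = ∫ r in Set.Ioc 0 s, (L r x - G r x) := by
    filter_upwards [hgood, ae_restrict_mem measurableSet_Ioc] with s hgs hst x
    have hle : volume.restrict (Set.Ioc 0 s) ≤ μ :=
      Measure.restrict_mono (Set.Ioc_subset_Ioc_right hst.2) le_rfl
    have e1 := h₁.torusConv_eq hη hs hst.1 x
    have e2 := h₂.torusConv_eq hη hs hst.1 x
    have a1 := (integrable_torusConv_time hlp hlc i1 x).mono_measure hle
    have a2 := (integrable_torusConv_time hlp hlc i2 x).mono_measure hle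
    have b1 := (integrable_torusConv_time hη hs.continuous p1 x).mono_measure hle
    have b2 := (integrable_torusConv_time hη hs.continuous p2 x).mono_measure hle
    have hc : ∫ r in Set.Ioc 0 s, (L r x - G r x)
        = ∫ r in Set.Ioc 0 s, ((torusConv (lapl η) (u₁ r) x - torusConv (lapl η) (u₂ r) x)
          - (torusConv η (fun y => u₁ r y ^ n) x - torusConv η (fun y => u₂ r y ^ n) x)) := by
      refine integral_congr_ae ?_
      filter_upwards [Measure.absolutelyContinuous_of_le hle hgood] with r hr
      simp only [hL, hG, hw, hf]
      rw [torusConv_sub hlp hlc hr.1 hr.2.1, torusConv_sub hη hs.continuous hr.2.2.1 hr.2.2.2]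
    have hVs : V s x = torusConv η (u₁ s) x - torusConv η (u₂ s) x :=
      torusConv_sub hη hs.continuous hgs.1 hgs.2.1 x
    have a12 : Integrable (fun r => torusConv (lapl η) (u₁ r) x - torusConv (lapl η) (u₂ r) x)
      (volume.restrict (Set.Ioc 0 s)) := a1.sub a2
    have b12 : Integrable (fun r => torusConv η (fun y => u₁ r y ^ n) x
      - torusConv η (fun y => u₂ r y ^ n) x) (volume.restrict (Set.Ioc 0 s)) := b1.sub b2
    rw [hc, hVs, integral_sub a12 b12, integral_sub a1 a2, integral_sub b1 b2]
    linarith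
  have hx : ∀ x, 0 ≤ ∫ s, (Real.arctan (V s x) * L s x - Real.arctan (V s x) * G s x) ∂μ := by
    intro x
    have hgi : Integrable (fun s => L s x - G s x) μ :=
      (integrable_torusConv_time hlp hlc wi x).sub
        (integrable_torusConv_time hη hs.continuous fi x)
    refine (setIntegral_arctan_primitive_mul_nonneg ht hgi).trans_eq ?_
    refine integral_congr_ae ?_
    filter_upwards [hVprim] with s hs
    rw [← hs x, mul_sub]
  have htot : 0 ≤ ∫ p, (Real.arctan (V p.1 p.2) * L p.1 p.2 - Real.arctan (V p.1 p.2) * G p.1 p.2)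
      ∂(μ.prod ν) := by
    have aLGi : Integrable (fun p : ℝ × (Fin d → ℝ) => Real.arctan (V p.1 p.2) * L p.1 p.2
      - Real.arctan (V p.1 p.2) * G p.1 p.2) (μ.prod ν) := aLi.sub aGi
    rw [integral_prod_symm _ aLGi]
    exact integral_nonneg hx
  have hdiss : ∫ p, Real.arctan (V p.1 p.2) * L p.1 p.2 ∂(μ.prod ν) ≤ 0 := by
    rw [integral_prod _ aLi]
    refine integral_nonpos_of_ae ?_
    filter_upwards [hgood] with s hgs
    exact setIntegral_arctan_mul_torusConv_lapl_nonpos hη hs (hgs.1.sub hgs.2.1)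
  rw [integral_sub aLi aGi] at htot
  exact (sub_nonneg.1 htot).trans hdiss

/-- The `ℤ^d`-periodic extension of a function supported near the origin. -/
noncomputable def periodize {d : ℕ} (φ : (Fin d → ℝ) → ℝ) (z : Fin d → ℝ) : ℝ :=
  φ fun i => z i - round (z i)

section Periodize

variable {d : ℕ} {φ : (Fin d → ℝ) → ℝ}

theorem isZdPeriodic_periodize (φ : (Fin d → ℝ) → ℝ) : IsZdPeriodic (periodize φ) := by
  intro x k
  unfold periodize
  congr 1
  ext i
  simp [round_add_intCast]

theorem periodize_eq_of_abs_le (hφ : ∀ z, (∃ i, 1 / 4 ≤ |z i|) → φ z = 0) {z : Fin d → ℝ}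
    (hz : ∀ i, |z i| ≤ 5 / 8) : periodize φ z = φ z := by
  unfold periodize
  by_cases h : ∀ i, round (z i) = 0
  · simp [h]
  · push Not at h
    obtain ⟨i, hi⟩ := h
    have hge : (1 : ℝ) ≤ |(round (z i) : ℝ)| := by exact_mod_cast Int.one_le_abs hi
    have hle := hz i
    have hr := abs_sub_round (z i)
    have h1 : 1 / 4 ≤ |z i - round (z i)| := by
      have := abs_sub_abs_le_abs_sub ((round (z i) : ℝ)) (z i)
      rw [abs_sub_comm] at this
      linarith
    have h2 : 1 / 4 ≤ |z i| := by
      have := abs_sub_abs_le_abs_sub ((round (z i) : ℝ)) (z i)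
      rw [abs_sub_comm] at this
      linarith
    rw [hφ _ ⟨i, h1⟩, hφ _ ⟨i, h2⟩]

theorem contDiff_periodize (hφ : ∀ z, (∃ i, 1 / 4 ≤ |z i|) → φ z = 0)
    (hs : ContDiff ℝ (⊤ : ℕ∞) φ) : ContDiff ℝ (⊤ : ℕ∞) (periodize φ) := by
  rw [contDiff_iff_contDiffAt]
  intro z₀
  have hc : ContDiff ℝ (⊤ : ℕ∞) fun z : Fin d → ℝ => φ (z - fun i => (round (z₀ i) : ℝ)) :=
    hs.comp (contDiff_id.sub contDiff_const)
  refine hc.contDiffAt.congr_of_eventuallyEq ?_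
  filter_upwards [Metric.ball_mem_nhds z₀ (by norm_num : (0 : ℝ) < 1 / 8)] with z hz
  have hper := isZdPeriodic_periodize φ (z - fun i => (round (z₀ i) : ℝ)) (fun i => round (z₀ i))
  rw [sub_add_cancel] at hper
  rw [hper]
  refine periodize_eq_of_abs_le hφ fun i => ?_
  have h1 := (dist_pi_lt_iff (by norm_num)).1 (Metric.mem_ball.1 hz) i
  rw [Real.dist_eq] at h1
  have h2 := abs_sub_round (z₀ i)
  have h3 := abs_add_le (z i - z₀ i) (z₀ i - round (z₀ i))
  rw [sub_add_sub_cancel] at h3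
  simp only [Pi.sub_apply]
  linarith

theorem torusConv_periodize {h : (Fin d → ℝ) → ℝ} (hφ : ∀ z, (∃ i, 1 / 4 ≤ |z i|) → φ z = 0)
    (hh : IsZdPeriodic h) (x : Fin d → ℝ) :
    torusConv (periodize φ) h x = ∫ y, h y * φ (x - y) := by
  have hp : IsZdPeriodic fun y => h y * periodize φ (x - y) := fun y k => by
    beta_reduce
    rw [hh, ← isZdPeriodic_periodize φ (x - (y + fun i => (k i : ℝ))) k]
    congr 2
    abel
  unfold torusConv
  rw [← hp.setIntegral_shift fun i => x i - 1 / 2]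
  have hm : MeasurableSet ((fun y => y - fun i => x i - 1 / 2) ⁻¹' TorusBox d) :=
    (measurable_id.sub_const _) (measurableSet_torusBox d)
  have he : ∫ y in (fun y => y - fun i => x i - 1 / 2) ⁻¹' TorusBox d, h y * φ (x - y)
      = ∫ y, h y * φ (x - y) := by
    refine setIntegral_eq_integral_of_forall_compl_eq_zero fun y hy => ?_
    rw [hφ, mul_zero]
    by_contra! hcon
    refine hy fun i _ => ?_
    have := abs_lt.1 (hcon i)
    simp only [Pi.sub_apply, Set.mem_Ico] at this ⊢
    constructor <;> linarith [this.1, this.2]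
  rw [← he]
  refine setIntegral_congr_fun hm fun y hy => ?_
  rw [periodize_eq_of_abs_le hφ]
  intro i
  have := hy i trivial
  simp only [Pi.sub_apply, Set.mem_Ico] at this ⊢
  rw [abs_le]
  constructor <;> linarith [this.1, this.2]

end Periodize

/-- Existence of a smooth periodic approximate identity with almost everywhere convergence. -/
theorem exists_periodic_mollifiers (d : ℕ) : ∃ η : ℕ → (Fin d → ℝ) → ℝ,
    (∀ m, IsZdPeriodic (η m)) ∧ (∀ m, ContDiff ℝ (⊤ : ℕ∞) (η m)) ∧ (∀ m x, 0 ≤ η m x) ∧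
    (∀ m, ∫ x in TorusBox d, η m x = 1) ∧
    ∀ h : (Fin d → ℝ) → ℝ, IsZdPeriodic h → IntegrableOn h (TorusBox d) →
      ∀ᵐ x, Tendsto (fun m => torusConv (η m) h x) atTop (𝓝 (h x)) := by
  let b : ℕ → ContDiffBump (0 : Fin d → ℝ) := fun m =>
    ⟨1 / 8 * (1 / ((m : ℝ) + 1)), 1 / 4 * (1 / ((m : ℝ) + 1)), by positivity, by
      have : 0 < 1 / ((m : ℝ) + 1) := by positivity
      linarith⟩
  have hb : ∀ m z, (∃ i, 1 / 4 ≤ |z i|) → (b m).normed volume z = 0 := by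
    rintro m z ⟨i, hi⟩
    rw [← Function.notMem_support, (b m).support_normed_eq, Metric.mem_ball, not_lt,
      dist_zero_right]
    refine le_trans ?_ (hi.trans (norm_le_pi_norm z i))
    change 1 / 4 * (1 / ((m : ℝ) + 1)) ≤ 1 / 4
    have : 1 / ((m : ℝ) + 1) ≤ 1 := by
      rw [div_le_one (by positivity)]
      linarith [Nat.cast_nonneg (α := ℝ) m]
    linarith
  refine ⟨fun m => periodize ((b m).normed volume), fun m => isZdPeriodic_periodize _,
    fun m => contDiff_periodize (hb m) (b m).contDiff_normed, fun m x => (b m).nonneg_normed _,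
    fun m => ?_, fun h hh hi => ?_⟩
  · have h1 := torusConv_periodize (hb m) (h := fun _ => 1) (fun _ _ => rfl) 0
    have h2 := integral_torusConv_eq (v := fun _ => (1 : ℝ)) (isZdPeriodic_periodize _)
      (contDiff_periodize (hb m) (b m).contDiff_normed).continuous
      (integrableOn_const (by simp [volume_torusBox]))
    have h3 : ∀ x, torusConv (periodize ((b m).normed volume)) (fun _ => 1) x = 1 := fun x => by
      rw [torusConv_periodize (hb m) (fun _ _ => rfl)]
      simp only [one_mul]
      rw [integral_sub_left_eq_self (fun y => (b m).normed volume y)]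
      exact (b m).integral_normed
    simpa [h3, volume_torusBox, Measure.real] using h2.symm
  · have ht : Tendsto (fun m => (b m).rOut) atTop (𝓝 0) := by
      have := (tendsto_one_div_add_atTop_nhds_zero_nat (𝕜 := ℝ)).const_mul (1 / 4)
      rwa [mul_zero] at this
    have := ContDiffBump.ae_convolution_tendsto_right_of_locallyIntegrable (μ := volume) (K := 2)
      ht (Eventually.of_forall fun m => by
        change 1 / 4 * (1 / ((m : ℝ) + 1)) ≤ 2 * (1 / 8 * (1 / ((m : ℝ) + 1)))
        linarith) (hh.locallyIntegrable hi)
    filter_upwards [this] with x hx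
    refine hx.congr fun m => ?_
    rw [convolution_eq_swap, torusConv_periodize (hb m) hh]
    simp [mul_comm]

/-- A consequence of Fatou's lemma: nonpositivity of integrals passes to almost everywhere limits
when the sequence is dominated by a convergent one whose integrals do not exceed the limiting
integral. -/
theorem integral_nonpos_of_ae_tendsto {α : Type*} [MeasurableSpace α] {μ : Measure α}
    {F G : ℕ → α → ℝ} {f g : α → ℝ} (hF : ∀ m, Integrable (F m) μ) (hG : ∀ m, Integrable (G m) μ)
    (hf : Integrable f μ) (hg : Integrable g μ) (hFG : ∀ m x, |F m x| ≤ G m x)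
    (hF0 : ∀ m, ∫ x, F m x ∂μ ≤ 0) (hGg : ∀ m, ∫ x, G m x ∂μ ≤ ∫ x, g x ∂μ)
    (hFf : ∀ᵐ x ∂μ, Tendsto (fun m => F m x) atTop (𝓝 (f x)))
    (hGt : ∀ᵐ x ∂μ, Tendsto (fun m => G m x) atTop (𝓝 (g x))) : ∫ x, f x ∂μ ≤ 0 := by
  have hpos : ∀ m x, 0 ≤ G m x + F m x := fun m x => by
    linarith [hFG m x, neg_abs_le (F m x)]
  have hlim : ∀ᵐ x ∂μ, Tendsto (fun m => G m x + F m x) atTop (𝓝 (g x + f x)) := by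
    filter_upwards [hFf, hGt] with x h1 h2 using h2.add h1
  have hpos' : 0 ≤ᵐ[μ] fun x => g x + f x := by
    filter_upwards [hlim] with x hx using ge_of_tendsto' hx fun m => hpos m x
  have hg0 : 0 ≤ ∫ x, g x ∂μ := by
    refine integral_nonneg_of_ae ?_
    filter_upwards [hGt] with x hx using
      ge_of_tendsto' hx fun m => (abs_nonneg _).trans (hFG m x)
  have key : ENNReal.ofReal (∫ x, g x + f x ∂μ) ≤ ENNReal.ofReal (∫ x, g x ∂μ) := by
    have hgf : Integrable (fun x => g x + f x) μ := hg.add hf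
    rw [ofReal_integral_eq_lintegral_ofReal hgf hpos']
    calc ∫⁻ x, ENNReal.ofReal (g x + f x) ∂μ
        = ∫⁻ x, liminf (fun m => ENNReal.ofReal (G m x + F m x)) atTop ∂μ := by
          refine lintegral_congr_ae ?_
          filter_upwards [hlim] with x hx using (ENNReal.tendsto_ofReal hx).liminf_eq.symm
      _ ≤ liminf (fun m => ∫⁻ x, ENNReal.ofReal (G m x + F m x) ∂μ) atTop :=
          lintegral_liminf_le' fun m =>
            ((hG m).add (hF m)).aestronglyMeasurable.aemeasurable.ennreal_ofReal
      _ ≤ ENNReal.ofReal (∫ x, g x ∂μ) := by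
          refine liminf_le_of_le (by isBoundedDefault) fun b hb => ?_
          obtain ⟨m, hm⟩ := hb.exists
          refine hm.trans ?_
          have hGF : Integrable (fun x => G m x + F m x) μ := (hG m).add (hF m)
          rw [← ofReal_integral_eq_lintegral_ofReal hGF (Eventually.of_forall (hpos m))]
          refine ENNReal.ofReal_le_ofReal ?_
          rw [integral_add (hG m) (hF m)]
          linarith [hF0 m, hGg m]
  have := (ENNReal.ofReal_le_ofReal_iff hg0).1 key
  rw [integral_add hg hf] at this
  linarith

section Mollified

variable {d : ℕ} {μ : Measure ℝ} {u : ℝ → (Fin d → ℝ) → ℝ}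

theorem ae_tendsto_torusConv_uncurry [SFinite μ] {η : ℕ → (Fin d → ℝ) → ℝ}
    (hc : ∀ m, Continuous (η m))
    (hη : ∀ h : (Fin d → ℝ) → ℝ, IsZdPeriodic h → IntegrableOn h (TorusBox d) →
      ∀ᵐ x, Tendsto (fun m => torusConv (η m) h x) atTop (𝓝 (h x)))
    (hu : Measurable (Function.uncurry u)) (hp : ∀ s, IsZdPeriodic (u s))
    (hi : Integrable (Function.uncurry u) (μ.prod (volume.restrict (TorusBox d)))) :
    ∀ᵐ p ∂μ.prod (volume.restrict (TorusBox d)),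
      Tendsto (fun m => torusConv (η m) (u p.1) p.2) atTop (𝓝 (u p.1 p.2)) := by
  have hm : MeasurableSet {p : ℝ × (Fin d → ℝ) |
      Tendsto (fun m => torusConv (η m) (u p.1) p.2) atTop (𝓝 (u p.1 p.2))} := by
    have : ∀ p : ℝ × (Fin d → ℝ),
        Tendsto (fun m => torusConv (η m) (u p.1) p.2) atTop (𝓝 (u p.1 p.2)) ↔
        Tendsto (fun m => torusConv (η m) (u p.1) p.2 - u p.1 p.2) atTop (𝓝 0) := fun p =>
      tendsto_sub_nhds_zero_iff.symm
    simp only [this]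
    exact measurableSet_tendsto _ fun m => (measurable_torusConv_uncurry (hc m) hu).sub hu
  rw [Measure.ae_prod_iff_ae_ae hm]
  filter_upwards [hi.prod_right_ae] with s hs
  exact ae_restrict_of_ae (hη (u s) (hp s) hs)

theorem integral_torusConv_uncurry [SFinite μ] {κ : (Fin d → ℝ) → ℝ} (hκ : IsZdPeriodic κ)
    (hc : Continuous κ) (hu : Measurable (Function.uncurry u))
    (hi : Integrable (Function.uncurry u) (μ.prod (volume.restrict (TorusBox d)))) :
    ∫ p, torusConv κ (u p.1) p.2 ∂μ.prod (volume.restrict (TorusBox d))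
      = (∫ p, u p.1 p.2 ∂μ.prod (volume.restrict (TorusBox d))) * ∫ x in TorusBox d, κ x := by
  have hi' : Integrable (fun p : ℝ × (Fin d → ℝ) => u p.1 p.2)
      (μ.prod (volume.restrict (TorusBox d))) := hi
  rw [integral_prod _ (integrable_torusConv_uncurry hκ hc hu hi), integral_prod _ hi',
    ← integral_mul_const]
  refine integral_congr_ae ?_
  filter_upwards [hi.prod_right_ae] with s hs using integral_torusConv_eq hκ hc hs

end Mollified

theorem abs_torusConv_le_torusConv_abs {d : ℕ} {κ v : (Fin d → ℝ) → ℝ} (hκ : ∀ x, 0 ≤ κ x)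
    (x : Fin d → ℝ) : |torusConv κ v x| ≤ torusConv κ (fun y => |v y|) x := by
  refine (abs_integral_le_integral_abs).trans (le_of_eq ?_)
  simp [torusConv, abs_mul, abs_of_nonneg (hκ _)]

theorem arctan_sub_mul_pow_sub_pos {n : ℕ} (hn : Odd n) {a b : ℝ} (hab : a ≠ b) :
    0 < Real.arctan (a - b) * (a ^ n - b ^ n) := by
  rcases lt_or_gt_of_ne hab with h | h
  · exact mul_pos_of_neg_of_neg (Real.arctan_lt_zero.2 (sub_neg.2 h))
      (sub_neg.2 (hn.strictMono_pow h))
  · exact mul_pos (Real.arctan_pos.2 (sub_pos.2 h)) (sub_pos.2 (hn.strictMono_pow h))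

theorem ae_eq_of_isWeakSolutionOddHeat {d n : ℕ} (hodd : Odd n) {u_in : (Fin d → ℝ) → ℝ}
    {u₁ u₂ : ℝ → (Fin d → ℝ) → ℝ} (h₁ : IsWeakSolutionOddHeat d n u_in u₁)
    (h₂ : IsWeakSolutionOddHeat d n u_in u₂) {t : ℝ} (ht : 0 ≤ t) :
    ∀ᵐ p ∂((volume.restrict (Set.Ioc 0 t)).prod (volume.restrict (TorusBox d))),
      u₁ p.1 p.2 = u₂ p.1 p.2 := by
  set P := ((volume : Measure ℝ).restrict (Set.Ioc 0 t)).prod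
    ((volume : Measure (Fin d → ℝ)).restrict (TorusBox d)) with hP
  have hn : n ≠ 0 := hodd.pos.ne'
  obtain ⟨η, hper, hsm, hnn, h1, hconv⟩ := exists_periodic_mollifiers d
  have hc : ∀ m, Continuous (η m) := fun m => (hsm m).continuous
  let w : ℝ → (Fin d → ℝ) → ℝ := fun s y => u₁ s y - u₂ s y
  let f : ℝ → (Fin d → ℝ) → ℝ := fun s y => u₁ s y ^ n - u₂ s y ^ n
  let g : ℝ → (Fin d → ℝ) → ℝ := fun s y => |f s y|
  have hwm : Measurable (Function.uncurry w) := h₁.1.sub h₂.1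
  have hfm : Measurable (Function.uncurry f) := (h₁.1.pow_const n).sub (h₂.1.pow_const n)
  have hgm : Measurable (Function.uncurry g) := hfm.abs
  have hwi : Integrable (Function.uncurry w) P := (h₁.integrable hn t).sub (h₂.integrable hn t)
  have hfi : Integrable (Function.uncurry f) P := (h₁.integrable_pow t).sub (h₂.integrable_pow t)
  have hgi : Integrable (Function.uncurry g) P := hfi.abs
  have hwp : ∀ s, IsZdPeriodic (w s) := fun s x k => by
    simp only [w, h₁.2.1 s x k, h₂.2.1 s x k]
  have hfp : ∀ s, IsZdPeriodic (f s) := fun s x k => by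
    simp only [f, h₁.2.1 s x k, h₂.2.1 s x k]
  have hgp : ∀ s, IsZdPeriodic (g s) := fun s x k => by simp only [g, hfp s x k]
  have hAi : ∀ {v : ℝ × (Fin d → ℝ) → ℝ} {z : ℝ × (Fin d → ℝ) → ℝ}, Measurable v →
      Integrable z P → Integrable (fun p => Real.arctan (v p) * z p) P := fun hv hz =>
    hz.bdd_mul (c := 2) (Real.measurable_arctan.comp hv).aestronglyMeasurable
      (Eventually.of_forall fun p => Real.abs_arctan_le_two _)
  have hle : ∫ p, Real.arctan (w p.1 p.2) * f p.1 p.2 ∂P ≤ 0 := by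
    refine integral_nonpos_of_ae_tendsto
      (F := fun m p => Real.arctan (torusConv (η m) (w p.1) p.2) * torusConv (η m) (f p.1) p.2)
      (G := fun m p => 2 * torusConv (η m) (g p.1) p.2)
      (g := fun p => 2 * g p.1 p.2)
      (fun m => hAi (measurable_torusConv_uncurry (hc m) hwm)
        (integrable_torusConv_uncurry (hper m) (hc m) hfm hfi))
      (fun m => (integrable_torusConv_uncurry (hper m) (hc m) hgm hgi).const_mul 2)
      (hAi hwm hfi) (hgi.const_mul 2) (fun m p => ?_)
      (fun m => integral_arctan_torusConv_mul_nonpos hn h₁ h₂ (hper m) (hsm m) ht)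
      (fun m => ?_) ?_ ?_
    · rw [abs_mul]
      exact mul_le_mul (Real.abs_arctan_le_two _) (abs_torusConv_le_torusConv_abs (hnn m) _)
        (abs_nonneg _) zero_le_two
    · rw [integral_const_mul, integral_const_mul,
        integral_torusConv_uncurry (hper m) (hc m) hgm hgi, h1, mul_one]
    · filter_upwards [ae_tendsto_torusConv_uncurry hc hconv hwm hwp hwi,
        ae_tendsto_torusConv_uncurry hc hconv hfm hfp hfi] with p hpw hpf
      exact ((Real.continuous_arctan.tendsto _).comp hpw).mul hpf
    · filter_upwards [ae_tendsto_torusConv_uncurry hc hconv hgm hgp hgi] with p hp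
      exact hp.const_mul 2
  have hpos : ∀ p : ℝ × (Fin d → ℝ), 0 ≤ Real.arctan (w p.1 p.2) * f p.1 p.2 := fun p => by
    by_cases h : u₁ p.1 p.2 = u₂ p.1 p.2
    · simp [w, h]
    · exact (arctan_sub_mul_pow_sub_pos hodd h).le
  have h0 := (integral_eq_zero_iff_of_nonneg hpos (hAi hwm hfi)).1
    (le_antisymm hle (integral_nonneg hpos))
  filter_upwards [h0] with p hp
  by_contra h
  exact (arctan_sub_mul_pow_sub_pos hodd h).ne' hp

/-- For `d ≥ 1` and odd `n ≥ 3`, weak solutions in `L^n((0,∞); L^n(𝕋^d))`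
of the heat equation with damping of odd power `∂_t u + u^n = Δ u`, `u|_{t=0} = u_in`,
with `u_in ∈ L^n(𝕋^d)`, are unique: any two coincide a.e. on `(0,∞) × 𝕋^d`. -/
theorem odd_damped_heat_weak_solution_unique (d n : ℕ) (hd : 1 ≤ d) (hn : 3 ≤ n)
    (hodd : Odd n) (u_in : (Fin d → ℝ) → ℝ) (hin_meas : Measurable u_in)
    (hin_per : IsZdPeriodic u_in)
    (hin_Ln : (∫⁻ x in TorusBox d, ENNReal.ofReal (|u_in x| ^ n)) < ⊤)
    (u₁ u₂ : ℝ → (Fin d → ℝ) → ℝ)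
    (h₁ : IsWeakSolutionOddHeat d n u_in u₁)
    (h₂ : IsWeakSolutionOddHeat d n u_in u₂) :
    ∀ᵐ p ∂(((volume : Measure ℝ).restrict (Set.Ioi 0)).prod
        ((volume : Measure (Fin d → ℝ)).restrict (TorusBox d))),
      u₁ p.1 p.2 = u₂ p.1 p.2 := by
  have hU : Set.Ioi (0 : ℝ) ×ˢ TorusBox d = ⋃ k : ℕ, Set.Ioc (0 : ℝ) k ×ˢ TorusBox d := by
    ext p
    simp only [Set.mem_prod, Set.mem_Ioi, Set.mem_iUnion, Set.mem_Ioc]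
    refine ⟨fun h => ?_, fun ⟨_, h, hx⟩ => ⟨h.1, hx⟩⟩
    obtain ⟨k, hk⟩ := exists_nat_ge p.1
    exact ⟨k, ⟨h.1, hk⟩, h.2⟩
  rw [Measure.prod_restrict, hU, ae_restrict_iUnion_iff]
  intro k
  rw [← Measure.prod_restrict]
  exact ae_eq_of_isWeakSolutionOddHeat hodd h₁ h₂ k.cast_nonneg
end

section
/- Let n ≥ 3 be an odd integer. Then for all real numbers a and b, ∑_{l=0}^{n−1} a^{n−1−l} b^l ≥ (1/2)(a^{n−1} + b^{n−1}). In particular, ∑_{l=0}^{n−1} a^{n−1−l} b^l ≥ 0. -/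
/-- Horner recurrence for the homogeneous geometric sum. -/
theorem sum_range_pow_mul_pow_succ {R : Type*} [CommSemiring R] (k : ℕ) (a b : R) :
    ∑ l ∈ Finset.range (k + 1), a ^ (k - l) * b ^ l =
      a * ∑ l ∈ Finset.range k, a ^ (k - 1 - l) * b ^ l + b ^ k := by
  rw [Finset.sum_range_succ, Finset.mul_sum, Nat.sub_self, pow_zero, one_mul]
  congr 1
  refine Finset.sum_congr rfl fun l hl => ?_
  have hl' := Finset.mem_range.mp hl
  rw [← mul_assoc, ← pow_succ', show k - 1 - l + 1 = k - l by omega]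

theorem even_pow_add_even_pow_le_two_mul_sum (m : ℕ) (a b : ℝ) :
    a ^ (2 * m) + b ^ (2 * m) ≤
      2 * ∑ l ∈ Finset.range (2 * m + 1), a ^ (2 * m - l) * b ^ l := by
  induction m with
  | zero => norm_num
  | succ m ih =>
    have h₁ := sum_range_pow_mul_pow_succ (2 * m + 1) a b
    have h₂ := sum_range_pow_mul_pow_succ (2 * m + 2) a b
    simp only [Nat.add_sub_cancel, show 2 * m + 2 - 1 = 2 * m + 1 by omega] at h₁ h₂
    rw [show 2 * (m + 1) = 2 * m + 2 by ring, h₂, h₁]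
    have h₃ := mul_le_mul_of_nonneg_left ih (sq_nonneg a)
    have h₄ : 0 ≤ b ^ (2 * m) * (a + b) ^ 2 :=
      mul_nonneg ((even_two_mul m).pow_nonneg b) (sq_nonneg _)
    linear_combination h₃ + h₄

/-- For odd `n ≥ 3` and all real `a b`,
`∑_{l=0}^{n-1} a^(n-1-l) b^l ≥ (1/2)(a^(n-1) + b^(n-1)) ≥ 0`. -/
theorem odd_power_cross_sum_lower_bound (n : ℕ) (hn : 3 ≤ n) (hodd : Odd n) (a b : ℝ) :
    (1 / 2) * (a ^ (n - 1) + b ^ (n - 1)) ≤ ∑ l ∈ Finset.range n, a ^ (n - 1 - l) * b ^ l ∧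
    0 ≤ ∑ l ∈ Finset.range n, a ^ (n - 1 - l) * b ^ l := by
  obtain ⟨m, rfl⟩ := hodd
  have h := even_pow_add_even_pow_le_two_mul_sum m a b
  have ha := (even_two_mul m).pow_nonneg a
  have hb := (even_two_mul m).pow_nonneg b
  simp only [Nat.add_sub_cancel]
  constructor <;> linarith
end

section
/- Let n ≥ 3 be an odd integer. Then for all real numbers a and b, (a − b)(a^n − b^n) ≥ (1/2)(a − b)^2 (a^{n−1} + b^{n−1}) ≥ 0. -/
theorem mul_sub_pow_sub_pow_nonneg {x y : ℝ} (hx : 0 ≤ x) (hy : 0 ≤ y) (k : ℕ) :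
    0 ≤ (x - y) * (x ^ k - y ^ k) := by
  rcases le_total x y with h | h
  · exact mul_nonneg_of_nonpos_of_nonpos (sub_nonpos.2 h)
      (sub_nonpos.2 (pow_le_pow_left₀ hx h k))
  · exact mul_nonneg (sub_nonneg.2 h) (sub_nonneg.2 (pow_le_pow_left₀ hy h k))

/-- For odd `n ≥ 3` and all real `a b`,
`(a - b)(a^n - b^n) ≥ (1/2)(a - b)^2 (a^(n-1) + b^(n-1)) ≥ 0`. -/
theorem odd_power_monotonicity (n : ℕ) (hn : 3 ≤ n) (hodd : Odd n) (a b : ℝ) :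
    (1 / 2) * (a - b) ^ 2 * (a ^ (n - 1) + b ^ (n - 1)) ≤ (a - b) * (a ^ n - b ^ n) ∧
    0 ≤ (1 / 2) * (a - b) ^ 2 * (a ^ (n - 1) + b ^ (n - 1)) := by
  obtain ⟨k, rfl⟩ := hodd
  rw [Nat.add_sub_cancel, pow_succ a, pow_succ b, pow_mul a, pow_mul b]
  refine ⟨?_, by positivity⟩
  linear_combination (1 / 2) * mul_sub_pow_sub_pow_nonneg (sq_nonneg a) (sq_nonneg b) k
end

section
/- Fix α > 1 and define g : ℝ → ℝ by g(t) = exp(−t^{−α}) for t > 0 and g(t) = 0 for t ≤ 0. Then the Tychonov series u(t,x) = ∑_{k=0}^{∞} (g^{(k)}(t)/(2k)!) |x|^{2k} converges for all (t,x) ∈ ℝ × ℝ and defines a smooth function satisfying the one-dimensional heat equation ∂_t u = ∂_{xx} u on ℝ × ℝ with u(0,x) = 0 for all x ∈ ℝ, and u is not identically zero. Consequently, the Cauchy problem for the heat equation on ℝ with zero initial data admits a nonzero solution, so solutions of the heat equation on ℝ are not unique without growth restrictions. -/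
/-- Tychonov's function `g(t) = exp(-t^(-α))` for `t > 0`, `g(t) = 0` for `t ≤ 0`. -/
noncomputable def tychG (α : ℝ) : ℝ → ℝ :=
  fun t => if 0 < t then Real.exp (-(t ^ (-α))) else 0

/-- The Tychonov series `u(t,x) = ∑_{k=0}^∞ (g^(k)(t)/(2k)!) |x|^(2k)`. -/
noncomputable def tychU (α : ℝ) (t x : ℝ) : ℝ :=
  ∑' k : ℕ, (iteratedDeriv k (tychG α) t / (Nat.factorial (2 * k) : ℝ)) * |x| ^ (2 * k)

open Filter Topology

/-- The solution `∑ dₙ(t) xⁿ / n!` of the heat equation built from a sequence `d` of functions with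
`dₙ' = dₙ₊₂`. -/
noncomputable def heatSeries (d : ℕ → ℝ → ℝ) (p : ℝ × ℝ) : ℝ :=
  ∑' n : ℕ, d n p.1 * (p.2 ^ n / (n.factorial : ℝ))

theorem summable_shift_mul_pow_div_factorial {B : ℕ → ℝ} (hB0 : ∀ n, 0 ≤ B n)
    (hB : ∀ R : ℝ, 0 ≤ R → Summable fun n : ℕ => B n * (R ^ n / (n.factorial : ℝ)))
    (R : ℝ) (hR : 0 ≤ R) :
    Summable fun n : ℕ => B (n + 1) * (R ^ n / (n.factorial : ℝ)) := by
  have h := (summable_nat_add_iff 1).2 (hB (2 * (R + 1)) (by positivity))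
  refine h.of_nonneg_of_le (fun n => mul_nonneg (hB0 _) (by positivity)) fun n => ?_
  refine mul_le_mul_of_nonneg_left ?_ (hB0 _)
  rw [div_le_div_iff₀ (by positivity) (by positivity), Nat.factorial_succ]
  push_cast
  have h1 : R ^ n ≤ (R + 1) ^ n := by gcongr; linarith
  have h2 : ((n : ℝ) + 1) ≤ 2 ^ (n + 1) := by
    exact_mod_cast (Nat.lt_two_pow_self (n := n + 1)).le
  have h3 : (1 : ℝ) ≤ R + 1 := by linarith
  calc R ^ n * ((n + 1) * n.factorial) ≤ (R + 1) ^ n * (2 ^ (n + 1) * n.factorial) := by gcongr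
    _ ≤ (R + 1) ^ n * (2 ^ (n + 1) * n.factorial) * (R + 1) :=
      le_mul_of_one_le_right (by positivity) h3
    _ = (2 * (R + 1)) ^ (n + 1) * n.factorial := by rw [mul_pow]; ring

theorem summable_heatSeries {d : ℕ → ℝ → ℝ} {B : ℕ → ℝ} (hdB : ∀ n t, |d n t| ≤ B n)
    (hB : ∀ R : ℝ, 0 ≤ R → Summable fun n : ℕ => B n * (R ^ n / (n.factorial : ℝ))) (p : ℝ × ℝ) :
    Summable fun n : ℕ => d n p.1 * (p.2 ^ n / (n.factorial : ℝ)) := by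
  refine (hB |p.2| (abs_nonneg _)).of_norm_bounded fun n => ?_
  rw [Real.norm_eq_abs, abs_mul, abs_div, abs_pow, Nat.abs_cast]
  gcongr
  exact hdB _ _

theorem hasDerivAt_pow_div_factorial (n : ℕ) (x : ℝ) :
    HasDerivAt (fun y : ℝ => y ^ n / (n.factorial : ℝ)) (n * x ^ (n - 1) / (n.factorial : ℝ)) x :=
  (hasDerivAt_pow n x).div_const _

theorem succ_mul_pow_div_factorial (n : ℕ) (x : ℝ) :
    ((n + 1 : ℕ) : ℝ) * x ^ (n + 1 - 1) / ((n + 1).factorial : ℝ) = x ^ n / n.factorial := by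
  rw [Nat.factorial_succ, Nat.add_sub_cancel]
  push_cast
  field_simp

theorem hasFDerivAt_heatSeries {d : ℕ → ℝ → ℝ} {B : ℕ → ℝ}
    (hd : ∀ n t, HasDerivAt (d n) (d (n + 2) t) t) (hdB : ∀ n t, |d n t| ≤ B n)
    (hB : ∀ R : ℝ, 0 ≤ R → Summable fun n : ℕ => B n * (R ^ n / (n.factorial : ℝ))) (p : ℝ × ℝ) :
    HasFDerivAt (heatSeries d)
      (heatSeries (fun n => d (n + 2)) p • ContinuousLinearMap.fst ℝ ℝ ℝ +
        heatSeries (fun n => d (n + 1)) p • ContinuousLinearMap.snd ℝ ℝ ℝ) p := by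
  have hB0 : ∀ n, 0 ≤ B n := fun n => (abs_nonneg _).trans (hdB n 0)
  have hB1 := summable_shift_mul_pow_div_factorial hB0 hB
  have hB2 := summable_shift_mul_pow_div_factorial (fun n => hB0 (n + 1)) hB1
  set R : ℝ := ‖p‖ + 1 with hRdef
  have hR : 0 ≤ R := by positivity
  let f' : ℕ → ℝ × ℝ → (ℝ × ℝ →L[ℝ] ℝ) := fun n q =>
    (d (n + 2) q.1 * (q.2 ^ n / (n.factorial : ℝ))) • ContinuousLinearMap.fst ℝ ℝ ℝ +
      (d n q.1 * (n * q.2 ^ (n - 1) / (n.factorial : ℝ))) • ContinuousLinearMap.snd ℝ ℝ ℝ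
  have hsum : Summable fun n : ℕ => B (n + 2) * (R ^ n / (n.factorial : ℝ)) +
      B n * (n * R ^ (n - 1) / (n.factorial : ℝ)) := by
    refine (hB2 R hR).add ((summable_nat_add_iff 1).1 ?_)
    simpa only [succ_mul_pow_div_factorial] using hB1 R hR
  have key : HasFDerivAt (heatSeries d) (∑' n, f' n p) p := by
    refine hasFDerivAt_tsum_of_isPreconnected (s := Metric.ball (0 : ℝ × ℝ) R) (x₀ := p)
      hsum Metric.isOpen_ball (convex_ball _ _).isPreconnected ?_ ?_ ?_
      (summable_heatSeries hdB hB p) ?_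
    · intro n q _
      have h1 := (hd n q.1).comp_hasFDerivAt q (hasFDerivAt_fst (𝕜 := ℝ) (p := q))
      have h2 := (hasDerivAt_pow_div_factorial n q.2).comp_hasFDerivAt q
        (hasFDerivAt_snd (𝕜 := ℝ) (p := q))
      refine (h1.mul h2).congr_fderiv ?_
      ext <;> simp [f', mul_comm]
    · intro n q hq
      have hq2 : |q.2| ≤ R := (norm_snd_le q).trans (mem_ball_zero_iff.1 hq).le
      refine (norm_add_le _ _).trans (add_le_add ?_ ?_)
      · rw [norm_smul, Real.norm_eq_abs, abs_mul, abs_div, abs_pow, Nat.abs_cast]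
        refine (mul_le_of_le_one_right (by positivity)
          (ContinuousLinearMap.norm_fst_le ℝ ℝ ℝ)).trans ?_
        have := hdB (n + 2) q.1
        have := hB0 (n + 2)
        gcongr
      · rw [norm_smul, Real.norm_eq_abs, abs_mul, abs_div, abs_mul, abs_pow, Nat.abs_cast,
          Nat.abs_cast]
        refine (mul_le_of_le_one_right (by positivity)
          (ContinuousLinearMap.norm_snd_le ℝ ℝ ℝ)).trans ?_
        have := hdB n q.1
        have := hB0 n
        gcongr
    · rw [mem_ball_zero_iff, hRdef]; linarith
    · rw [mem_ball_zero_iff, hRdef]; linarith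
  refine key.congr_fderiv (HasSum.tsum_eq ?_)
  have s2 := (summable_heatSeries (fun n t => hdB (n + 2) t) hB2 p).hasSum
  have s1 := (summable_heatSeries (fun n t => hdB (n + 1) t) hB1 p).hasSum
  have s1' : HasSum (fun n : ℕ => d n p.1 * (n * p.2 ^ (n - 1) / (n.factorial : ℝ)))
      (heatSeries (fun n => d (n + 1)) p) := by
    refine (hasSum_nat_add_iff' 1).1 ?_
    simpa only [succ_mul_pow_div_factorial, Finset.sum_range_one, Nat.cast_zero, zero_mul,
      zero_div, mul_zero, sub_zero] using! s1
  exact (s2.smul_const _).add (s1'.smul_const _)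

theorem contDiff_heatSeries {d : ℕ → ℝ → ℝ} {B : ℕ → ℝ}
    (hd : ∀ n t, HasDerivAt (d n) (d (n + 2) t) t) (hdB : ∀ n t, |d n t| ≤ B n)
    (hB : ∀ R : ℝ, 0 ≤ R → Summable fun n : ℕ => B n * (R ^ n / (n.factorial : ℝ))) :
    ContDiff ℝ (⊤ : ℕ∞) (heatSeries d) := by
  refine contDiff_infty.2 fun m => ?_
  induction m generalizing d B with
  | zero =>
    exact contDiff_zero.2 <| continuous_iff_continuousAt.2 fun p =>
      (hasFDerivAt_heatSeries hd hdB hB p).continuousAt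
  | succ m ih =>
    have hB0 : ∀ n, 0 ≤ B n := fun n => (abs_nonneg _).trans (hdB n 0)
    have hB1 := summable_shift_mul_pow_div_factorial hB0 hB
    have hB2 := summable_shift_mul_pow_div_factorial (fun n => hB0 (n + 1)) hB1
    push_cast
    refine contDiff_succ_iff_hasFDerivAt.2 ⟨_, ?_, hasFDerivAt_heatSeries hd hdB hB⟩
    exact ((ih (fun n => hd (n + 2)) (fun n => hdB (n + 2)) hB2).smul contDiff_const).add
      ((ih (fun n => hd (n + 1)) (fun n => hdB (n + 1)) hB1).smul contDiff_const)

theorem hasDerivAt_heatSeries_fst {d : ℕ → ℝ → ℝ} {B : ℕ → ℝ}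
    (hd : ∀ n t, HasDerivAt (d n) (d (n + 2) t) t) (hdB : ∀ n t, |d n t| ≤ B n)
    (hB : ∀ R : ℝ, 0 ≤ R → Summable fun n : ℕ => B n * (R ^ n / (n.factorial : ℝ))) (t x : ℝ) :
    HasDerivAt (fun τ => heatSeries d (τ, x)) (heatSeries (fun n => d (n + 2)) (t, x)) t := by
  simpa using! (hasFDerivAt_heatSeries hd hdB hB (t, x)).comp_hasDerivAt t
    ((hasDerivAt_id t).prodMk (hasDerivAt_const t x))

theorem hasDerivAt_heatSeries_snd {d : ℕ → ℝ → ℝ} {B : ℕ → ℝ}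
    (hd : ∀ n t, HasDerivAt (d n) (d (n + 2) t) t) (hdB : ∀ n t, |d n t| ≤ B n)
    (hB : ∀ R : ℝ, 0 ≤ R → Summable fun n : ℕ => B n * (R ^ n / (n.factorial : ℝ))) (t x : ℝ) :
    HasDerivAt (fun y => heatSeries d (t, y)) (heatSeries (fun n => d (n + 1)) (t, x)) x := by
  simpa using! (hasFDerivAt_heatSeries hd hdB hB (t, x)).comp_hasDerivAt x
    ((hasDerivAt_const x t).prodMk (hasDerivAt_id x))

theorem deriv_heatSeries_fst_eq_deriv_deriv_snd {d : ℕ → ℝ → ℝ} {B : ℕ → ℝ}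
    (hd : ∀ n t, HasDerivAt (d n) (d (n + 2) t) t) (hdB : ∀ n t, |d n t| ≤ B n)
    (hB : ∀ R : ℝ, 0 ≤ R → Summable fun n : ℕ => B n * (R ^ n / (n.factorial : ℝ))) (t x : ℝ) :
    deriv (fun τ => heatSeries d (τ, x)) t = deriv (deriv fun y => heatSeries d (t, y)) x := by
  have hB0 : ∀ n, 0 ≤ B n := fun n => (abs_nonneg _).trans (hdB n 0)
  have hB1 := summable_shift_mul_pow_div_factorial hB0 hB
  rw [(hasDerivAt_heatSeries_fst hd hdB hB t x).deriv,
    funext fun y => (hasDerivAt_heatSeries_snd hd hdB hB t y).deriv]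
  exact (hasDerivAt_heatSeries_snd (fun n => hd (n + 1)) (fun n => hdB (n + 1)) hB1 t x).deriv.symm

theorem exists_half_le_re_cpow_neg (α : ℝ) :
    ∃ θ : ℝ, 0 < θ ∧ θ < 1 ∧ ∀ w : ℂ, ‖w - 1‖ ≤ θ → 1 / 2 ≤ (w ^ (-α : ℂ)).re := by
  have hc : ContinuousAt (fun w : ℂ => (w ^ (-α : ℂ)).re) 1 :=
    Complex.continuous_re.continuousAt.comp
      (continuousAt_id.cpow continuousAt_const Complex.one_mem_slitPlane)
  have hev : ∀ᶠ w in 𝓝 (1 : ℂ), 1 / 2 < (w ^ (-α : ℂ)).re :=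
    hc.eventually_const_lt (by norm_num)
  obtain ⟨ε, hε, h⟩ := Metric.eventually_nhds_iff.1 hev
  refine ⟨min (ε / 2) (1 / 2), by positivity,
    (min_le_right _ _).trans_lt (by norm_num), fun w hw => (h ?_).le⟩
  rw [dist_eq_norm]
  have := hw.trans (min_le_left _ _)
  linarith

/-- The holomorphic extension of `tychG α` from the positive half-line. -/
noncomputable def tychGComplex (α : ℝ) (z : ℂ) : ℂ :=
  Complex.exp (-(z ^ (-α : ℂ)))

theorem differentiableOn_tychGComplex (α : ℝ) :
    DifferentiableOn ℂ (tychGComplex α) Complex.slitPlane := fun _ hz =>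
  (((differentiableAt_id.cpow (differentiableAt_const _) hz).neg).cexp).differentiableWithinAt

theorem analyticAt_tychGComplex (α : ℝ) {t : ℝ} (ht : 0 < t) :
    AnalyticAt ℂ (tychGComplex α) t :=
  (differentiableOn_tychGComplex α).analyticAt
    (Complex.isOpen_slitPlane.mem_nhds (Complex.ofReal_mem_slitPlane.2 ht))

theorem hasDerivAt_re_iteratedDeriv_tychGComplex (α : ℝ) (k : ℕ) {t : ℝ} (ht : 0 < t) :
    HasDerivAt (fun x : ℝ => (iteratedDeriv k (tychGComplex α) x).re)
      (iteratedDeriv (k + 1) (tychGComplex α) t).re t := by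
  have h := (analyticAt_tychGComplex α ht).iterated_deriv k
  rw [← iteratedDeriv_eq_iterate] at h
  rw [iteratedDeriv_succ]
  exact h.differentiableAt.hasDerivAt.real_of_complex

theorem iteratedDeriv_tychG_of_pos (α : ℝ) (k : ℕ) {t : ℝ} (ht : 0 < t) :
    iteratedDeriv k (tychG α) t = (iteratedDeriv k (tychGComplex α) t).re := by
  induction k generalizing t with
  | zero =>
    simp only [iteratedDeriv_zero, tychG, tychGComplex, if_pos ht]
    rw [← Complex.ofReal_neg, ← Complex.ofReal_cpow ht.le, ← Complex.ofReal_neg,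
      Complex.exp_ofReal_re]
  | succ k ih =>
    rw [iteratedDeriv_succ]
    refine ((hasDerivAt_re_iteratedDeriv_tychGComplex α k ht).congr_of_eventuallyEq ?_).deriv
    filter_upwards [lt_mem_nhds ht] with s hs using ih hs

theorem exists_abs_iteratedDeriv_tychG_le (α : ℝ) :
    ∃ θ : ℝ, 0 < θ ∧ ∀ (k : ℕ) (t : ℝ), 0 < t →
      |iteratedDeriv k (tychG α) t| ≤
        k.factorial * Real.exp (-(t ^ (-α) / 2)) / (θ * t) ^ k := by
  obtain ⟨θ, hθ, hθ1, h⟩ := exists_half_le_re_cpow_neg α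
  refine ⟨θ, hθ, fun k t ht => ?_⟩
  have htc : (t : ℂ) ≠ 0 := Complex.ofReal_ne_zero.2 ht.ne'
  have hw : ∀ z ∈ Metric.closedBall (t : ℂ) (θ * t), ‖z / t - 1‖ ≤ θ := by
    intro z hz
    rw [div_sub_one htc, norm_div, Complex.norm_of_nonneg ht.le, div_le_iff₀ ht]
    exact mem_closedBall_iff_norm.1 hz
  have hslit : Metric.closedBall (t : ℂ) (θ * t) ⊆ Complex.slitPlane := by
    intro z hz
    refine Or.inl ?_
    have h1 := (Complex.abs_re_le_norm _).trans (mem_closedBall_iff_norm.1 hz)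
    rw [Complex.sub_re, Complex.ofReal_re] at h1
    nlinarith [(abs_le.1 h1).1]
  rw [iteratedDeriv_tychG_of_pos α k ht]
  refine (Complex.abs_re_le_norm _).trans ?_
  refine Complex.norm_iteratedDeriv_le_of_forall_mem_sphere_norm_le k (by positivity)
    (((differentiableOn_tychGComplex α).mono ?_).diffContOnCl) fun z hz => ?_
  · exact Metric.closure_ball_subset_closedBall.trans hslit
  · have hz' := Metric.sphere_subset_closedBall hz
    have hz0 : z ≠ 0 := Complex.slitPlane_ne_zero (hslit hz')
    have hzt : z = t * (z / t) := by field_simp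
    have hpow : z ^ (-α : ℂ) = (t ^ (-α) : ℝ) * (z / t) ^ (-α : ℂ) := by
      conv_lhs => rw [hzt]
      have hzt0 : z / t ≠ 0 := div_ne_zero hz0 htc
      rw [Complex.cpow_def_of_ne_zero (mul_ne_zero htc hzt0), Complex.log_ofReal_mul ht hzt0,
        Complex.ofReal_log ht.le, add_mul, Complex.exp_add, ← Complex.cpow_def_of_ne_zero htc,
        ← Complex.cpow_def_of_ne_zero hzt0, Complex.ofReal_cpow ht.le, Complex.ofReal_neg]
    rw [tychGComplex, Complex.norm_exp, Real.exp_le_exp, Complex.neg_re, hpow, Complex.re_ofReal_mul]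
    have := mul_le_mul_of_nonneg_left (h _ (hw z hz')) (Real.rpow_nonneg ht.le (-α))
    linarith

theorem exp_neg_rpow_neg_le {α : ℝ} (hα : 1 < α) (k : ℕ) {t : ℝ} (ht : 0 < t) :
    Real.exp (-(t ^ (-α) / 2)) ≤ 2 ^ k * (k.factorial : ℝ) ^ (1 / α) * t ^ k := by
  have hα0 : 0 < α := by linarith
  have hy : 0 ≤ t ^ (-α) / 2 := by positivity
  have hi : 1 / α ≤ 1 := by rw [div_le_one hα0]; exact hα.le
  have hi0 : 0 ≤ 1 / α := by positivity
  have h1 : (t ^ (-α) / 2) ^ k ≤ k.factorial * Real.exp (t ^ (-α) / 2) := by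
    have := Real.pow_div_factorial_le_exp _ hy k
    rwa [div_le_iff₀' (by positivity)] at this
  have h2 := Real.rpow_le_rpow (by positivity) h1 hi0
  have e1 : ((t ^ (-α) / 2) ^ k) ^ (1 / α) = (t⁻¹) ^ k / ((2 : ℝ) ^ k) ^ (1 / α) := by
    rw [div_pow, Real.div_rpow (by positivity) (by positivity), ← Real.rpow_natCast (t ^ (-α)),
      ← Real.rpow_mul ht.le, ← Real.rpow_mul ht.le, inv_pow, ← Real.rpow_natCast t,
      ← Real.rpow_neg ht.le]
    congr 2
    field_simp
  have h3 : ((2 : ℝ) ^ k) ^ (1 / α) ≤ 2 ^ k :=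
    Real.rpow_le_self_of_one_le (one_le_pow₀ (by norm_num)) hi
  have h4 : (Real.exp (t ^ (-α) / 2)) ^ (1 / α) ≤ Real.exp (t ^ (-α) / 2) :=
    Real.rpow_le_self_of_one_le (Real.one_le_exp hy) hi
  rw [e1, Real.mul_rpow (by positivity) (by positivity), div_le_iff₀ (by positivity)] at h2
  have h5 : (t⁻¹) ^ k ≤ 2 ^ k * (k.factorial : ℝ) ^ (1 / α) * Real.exp (t ^ (-α) / 2) := by
    calc (t⁻¹) ^ k ≤ _ := h2
      _ ≤ (k.factorial : ℝ) ^ (1 / α) * Real.exp (t ^ (-α) / 2) * 2 ^ k := by gcongr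
      _ = _ := by ring
  rw [Real.exp_neg, inv_le_iff_one_le_mul₀ (by positivity)]
  rw [inv_pow, inv_le_iff_one_le_mul₀ (by positivity)] at h5
  linarith

theorem exists_abs_iteratedDeriv_tychG_le_mul_sq {α : ℝ} (hα : 1 < α) (k : ℕ) :
    ∃ C : ℝ, ∀ t : ℝ, 0 < t → |iteratedDeriv k (tychG α) t| ≤ C * t ^ 2 := by
  obtain ⟨θ, hθ, h⟩ := exists_abs_iteratedDeriv_tychG_le α
  refine ⟨k.factorial * (2 ^ (k + 2) * ((k + 2).factorial : ℝ) ^ (1 / α)) / θ ^ k,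
    fun t ht => (h k t ht).trans ?_⟩
  have := exp_neg_rpow_neg_le hα (k + 2) ht
  calc k.factorial * Real.exp (-(t ^ (-α) / 2)) / (θ * t) ^ k
      ≤ k.factorial * (2 ^ (k + 2) * ((k + 2).factorial : ℝ) ^ (1 / α) * t ^ (k + 2)) /
        (θ * t) ^ k := by gcongr
    _ = _ := by rw [mul_pow]; field_simp; ring

theorem hasDerivAt_zero_of_abs_le_mul_sq {f : ℝ → ℝ} {C : ℝ} (h0 : ∀ t ≤ 0, f t = 0)
    (hC : ∀ t, 0 < t → |f t| ≤ C * t ^ 2) {t : ℝ} (ht : t ≤ 0) : HasDerivAt f 0 t := by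
  rcases ht.lt_or_eq with ht | rfl
  · refine (hasDerivAt_const t (0 : ℝ)).congr_of_eventuallyEq ?_
    filter_upwards [gt_mem_nhds ht] with s hs using h0 s hs.le
  · have hO : f =O[𝓝 0] fun x : ℝ => ‖x - 0‖ ^ 2 := by
      refine Asymptotics.IsBigO.of_bound |C| (Eventually.of_forall fun x => ?_)
      rw [sub_zero, Real.norm_eq_abs, norm_pow, norm_norm, Real.norm_eq_abs, sq_abs]
      rcases le_or_gt x 0 with hx | hx
      · rw [h0 x hx, abs_zero]; positivity
      · exact (hC x hx).trans (by gcongr; exact le_abs_self C)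
    simpa using! (hO.hasFDerivAt (𝕜 := ℝ) one_lt_two).hasDerivAt

theorem iteratedDeriv_tychG_of_nonpos {α : ℝ} (hα : 1 < α) (k : ℕ) {t : ℝ} (ht : t ≤ 0) :
    iteratedDeriv k (tychG α) t = 0 := by
  induction k generalizing t with
  | zero => simp [tychG, ht.not_gt]
  | succ k ih =>
    obtain ⟨C, hC⟩ := exists_abs_iteratedDeriv_tychG_le_mul_sq hα k
    rw [iteratedDeriv_succ]
    exact (hasDerivAt_zero_of_abs_le_mul_sq (fun _ => ih) hC ht).deriv

theorem hasDerivAt_iteratedDeriv_tychG {α : ℝ} (hα : 1 < α) (k : ℕ) (t : ℝ) :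
    HasDerivAt (iteratedDeriv k (tychG α)) (iteratedDeriv (k + 1) (tychG α) t) t := by
  rcases le_or_gt t 0 with ht | ht
  · obtain ⟨C, hC⟩ := exists_abs_iteratedDeriv_tychG_le_mul_sq hα k
    rw [iteratedDeriv_tychG_of_nonpos hα (k + 1) ht]
    exact hasDerivAt_zero_of_abs_le_mul_sq (fun _ => iteratedDeriv_tychG_of_nonpos hα k) hC ht
  · rw [iteratedDeriv_tychG_of_pos α (k + 1) ht]
    refine (hasDerivAt_re_iteratedDeriv_tychGComplex α k ht).congr_of_eventuallyEq ?_
    filter_upwards [lt_mem_nhds ht] with s hs using iteratedDeriv_tychG_of_pos α k hs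

theorem exists_abs_iteratedDeriv_tychG_le_pow_mul_factorial {α : ℝ} (hα : 1 < α) :
    ∃ L : ℝ, 1 ≤ L ∧ ∀ (k : ℕ) (t : ℝ),
      |iteratedDeriv k (tychG α) t| ≤ L ^ k * (k.factorial : ℝ) ^ (1 + 1 / α) := by
  obtain ⟨θ, hθ, h⟩ := exists_abs_iteratedDeriv_tychG_le α
  refine ⟨max 1 (2 / θ), le_max_left _ _, fun k t => ?_⟩
  rcases le_or_gt t 0 with ht | ht
  · rw [iteratedDeriv_tychG_of_nonpos hα k ht, abs_zero]
    positivity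
  · have := exp_neg_rpow_neg_le hα k ht
    calc |iteratedDeriv k (tychG α) t|
        ≤ k.factorial * Real.exp (-(t ^ (-α) / 2)) / (θ * t) ^ k := h k t ht
      _ ≤ k.factorial * (2 ^ k * (k.factorial : ℝ) ^ (1 / α) * t ^ k) / (θ * t) ^ k := by gcongr
      _ = (2 / θ) ^ k * (k.factorial : ℝ) ^ (1 + 1 / α) := by
        rw [Real.rpow_add (by positivity), Real.rpow_one, mul_pow, div_pow]
        field_simp
      _ ≤ _ := by gcongr; exact le_max_right _ _

theorem summable_pow_mul_factorial_rpow {β : ℝ} (hβ : β < 1) {L : ℝ} (hL : 0 < L) (R : ℝ)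
    (hR : 0 ≤ R) :
    Summable fun n : ℕ =>
      L ^ n * (n.factorial : ℝ) ^ β * (R ^ n / (n.factorial : ℝ)) := by
  rcases hR.eq_or_lt with rfl | hR
  · exact summable_of_ne_finset_zero (s := {0}) fun n hn => by
      simp [zero_pow (Finset.notMem_singleton.1 hn)]
  refine summable_of_ratio_test_tendsto_lt_one zero_lt_one
    (Eventually.of_forall fun n => by positivity) ?_
  have hlim : Tendsto (fun n : ℕ => L * R * ((n + 1 : ℕ) : ℝ) ^ (-(1 - β))) atTop (𝓝 0) := by
    simpa using! (((tendsto_rpow_neg_atTop (sub_pos.2 hβ)).comp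
      tendsto_natCast_atTop_atTop).comp (tendsto_add_atTop_nat 1)).const_mul (L * R)
  refine hlim.congr fun n => ?_
  rw [Real.norm_of_nonneg (by positivity), Real.norm_of_nonneg (by positivity), neg_sub,
    Real.rpow_sub (by positivity), Real.rpow_one, Nat.factorial_succ, Nat.cast_mul,
    Real.mul_rpow (by positivity) (by positivity)]
  field_simp
  ring

/-- The derivatives of `tychG α`, placed at the even indices. -/
noncomputable def tychCoeff (α : ℝ) (n : ℕ) (t : ℝ) : ℝ :=
  if Even n then iteratedDeriv (n / 2) (tychG α) t else 0

theorem tychCoeff_two_mul (α : ℝ) (k : ℕ) (t : ℝ) :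
    tychCoeff α (2 * k) t = iteratedDeriv k (tychG α) t := by
  simp [tychCoeff]

theorem tychCoeff_of_not_even (α : ℝ) {n : ℕ} (hn : ¬ Even n) (t : ℝ) :
    tychCoeff α n t = 0 :=
  if_neg hn

theorem hasDerivAt_tychCoeff {α : ℝ} (hα : 1 < α) (n : ℕ) (t : ℝ) :
    HasDerivAt (tychCoeff α n) (tychCoeff α (n + 2) t) t := by
  rcases em (Even n) with hn | hn
  · obtain ⟨k, rfl⟩ := even_iff_exists_two_mul.1 hn
    rw [show 2 * k + 2 = 2 * (k + 1) by ring, tychCoeff_two_mul,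
      funext fun t => tychCoeff_two_mul α k t]
    exact hasDerivAt_iteratedDeriv_tychG hα k t
  · rw [tychCoeff_of_not_even α (by simpa [Nat.even_add] using hn),
      funext fun t => tychCoeff_of_not_even α hn t]
    exact hasDerivAt_const t 0

theorem exists_abs_tychCoeff_le {α : ℝ} (hα : 1 < α) :
    ∃ B : ℕ → ℝ, (∀ n t, |tychCoeff α n t| ≤ B n) ∧
      ∀ R : ℝ, 0 ≤ R → Summable fun n : ℕ => B n * (R ^ n / (n.factorial : ℝ)) := by
  obtain ⟨L, hL, h⟩ := exists_abs_iteratedDeriv_tychG_le_pow_mul_factorial hα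
  have hi : 1 / α < 1 := by rw [div_lt_one (by linarith)]; exact hα
  have hi0 : 0 < 1 / α := by positivity
  refine ⟨fun n => L ^ n * (n.factorial : ℝ) ^ ((1 + 1 / α) / 2), fun n t => ?_,
    summable_pow_mul_factorial_rpow (by linarith) (by linarith)⟩
  rcases em (Even n) with hn | hn
  · obtain ⟨k, rfl⟩ := even_iff_exists_two_mul.1 hn
    rw [tychCoeff_two_mul]
    have hfac : (k.factorial : ℝ) ^ 2 ≤ ((2 * k).factorial : ℝ) := by
      rw [sq, two_mul]
      exact_mod_cast Nat.le_of_dvd (Nat.factorial_pos _)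
        (Nat.factorial_mul_factorial_dvd_factorial_add k k)
    calc |iteratedDeriv k (tychG α) t| ≤ L ^ k * (k.factorial : ℝ) ^ (1 + 1 / α) := h k t
      _ = L ^ k * ((k.factorial : ℝ) ^ 2) ^ ((1 + 1 / α) / 2) := by
        rw [← Real.rpow_natCast_mul (by positivity)]
        congr 2
        push_cast
        ring
      _ ≤ _ := by
        exact mul_le_mul (pow_le_pow_right₀ hL (by omega))
          (Real.rpow_le_rpow (by positivity) hfac (by positivity)) (by positivity) (by positivity)
  · rw [tychCoeff_of_not_even α hn, abs_zero]
    positivity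

theorem hasSum_tychU {α : ℝ} (hα : 1 < α) (t x : ℝ) :
    HasSum (fun k : ℕ =>
      (iteratedDeriv k (tychG α) t / (Nat.factorial (2 * k) : ℝ)) * |x| ^ (2 * k))
      (heatSeries (tychCoeff α) (t, x)) := by
  obtain ⟨B, hdB, hB⟩ := exists_abs_tychCoeff_le hα
  have hs := (summable_heatSeries hdB hB (t, x)).hasSum
  have hinj : Function.Injective fun k : ℕ => 2 * k := fun a b h => by simpa using h
  rw [← hinj.hasSum_iff] at hs
  · refine hs.congr_fun fun k => ?_
    simp only [Function.comp_apply, tychCoeff_two_mul, (even_two_mul k).pow_abs]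
    ring
  · intro n hn
    rw [tychCoeff_of_not_even, zero_mul]
    exact fun he => hn ((even_iff_exists_two_mul.1 he).imp fun _ h => h.symm)

theorem tychU_eq_heatSeries {α : ℝ} (hα : 1 < α) (t x : ℝ) :
    tychU α t x = heatSeries (tychCoeff α) (t, x) :=
  (hasSum_tychU hα t x).tsum_eq

theorem tychU_zero_left {α : ℝ} (hα : 1 < α) (x : ℝ) : tychU α 0 x = 0 := by
  simp [tychU, iteratedDeriv_tychG_of_nonpos hα _ le_rfl]

theorem tychU_zero_right (α t : ℝ) : tychU α t 0 = tychG α t := by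
  rw [tychU, tsum_eq_single 0 fun k hk => by simp [hk]]
  simp

/-- For `α > 1`, the Tychonov series converges for all `(t,x)`, defines a
smooth function solving the 1D heat equation `∂_t u = ∂_{xx} u` on `ℝ × ℝ` with
`u(0,·) ≡ 0`, which is not identically zero. Consequently, the Cauchy problem for the
heat equation on `ℝ` with zero initial data admits a nonzero (smooth) solution, so
solutions of the heat equation on `ℝ` are not unique without growth restrictions. -/
theorem tychonov_nonuniqueness (α : ℝ) (hα : 1 < α) :
    (∀ t x : ℝ, Summable fun k : ℕ =>
      (iteratedDeriv k (tychG α) t / (Nat.factorial (2 * k) : ℝ)) * |x| ^ (2 * k)) ∧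
    ContDiff ℝ (⊤ : ℕ∞) (fun p : ℝ × ℝ => tychU α p.1 p.2) ∧
    (∀ t x : ℝ, deriv (fun τ => tychU α τ x) t = deriv (deriv (fun y => tychU α t y)) x) ∧
    (∀ x : ℝ, tychU α 0 x = 0) ∧
    (∃ t x : ℝ, tychU α t x ≠ 0) ∧
    ∃ u : ℝ → ℝ → ℝ,
      ContDiff ℝ (⊤ : ℕ∞) (fun p : ℝ × ℝ => u p.1 p.2) ∧
      (∀ t x : ℝ, deriv (fun τ => u τ x) t = deriv (deriv (fun y => u t y)) x) ∧
      (∀ x : ℝ, u 0 x = 0) ∧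
      ∃ t x : ℝ, u t x ≠ 0 := by
  obtain ⟨B, hdB, hB⟩ := exists_abs_tychCoeff_le hα
  have hd := hasDerivAt_tychCoeff hα
  have hsmooth : ContDiff ℝ (⊤ : ℕ∞) (fun p : ℝ × ℝ => tychU α p.1 p.2) := by
    simpa only [tychU_eq_heatSeries hα] using contDiff_heatSeries hd hdB hB
  have hheat : ∀ t x : ℝ,
      deriv (fun τ => tychU α τ x) t = deriv (deriv (fun y => tychU α t y)) x := by
    simpa only [tychU_eq_heatSeries hα] using deriv_heatSeries_fst_eq_deriv_deriv_snd hd hdB hB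
  have hne : ∃ t x : ℝ, tychU α t x ≠ 0 := by
    refine ⟨1, 0, ?_⟩
    rw [tychU_zero_right, tychG, if_pos one_pos]
    exact Real.exp_ne_zero _
  exact ⟨fun t x => (hasSum_tychU hα t x).summable, hsmooth, hheat, tychU_zero_left hα, hne,
    tychU α, hsmooth, hheat, tychU_zero_left hα, hne⟩
end
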